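/- Let n ≥ 5 and 1 < p < (n+4)/(n-4). There exists a constant C, depending only on n and p, such that every nonnegative C⁴ solution u of Δ²u = u^p in the punctured ball B₁\{0} ⊂ ℝⁿ satisfies u(x) ≤ C |x|^{-4/(p-1)} for all x with 0 < |x| ≤ 1/2. -/

import Mathlib

open MeasureTheory Metric Filter

/-- The Euclidean Laplacian `Δu` of `u : ℝⁿ → ℝ`, computed as the trace of the second
derivative: `Δu(x) = ∑ i, ∂²u/∂xᵢ²(x)`. -/
noncomputable def lap {n : ℕ} (u : EuclideanSpace ℝ (Fin n) → ℝ) :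
    EuclideanSpace ℝ (Fin n) → ℝ :=
  fun x => ∑ i : Fin n,
    iteratedFDeriv ℝ 2 u x ![EuclideanSpace.single i 1, EuclideanSpace.single i 1]

/-- The biharmonic operator `Δ²u = Δ(Δu)`. -/
noncomputable def bilap {n : ℕ} (u : EuclideanSpace ℝ (Fin n) → ℝ) :
    EuclideanSpace ℝ (Fin n) → ℝ :=
  lap (lap u)

namespace Biharmonic

open scoped Topology Pointwise ContDiff

/-- Euclidean space of dimension `n`. -/
abbrev Eu (n : ℕ) := EuclideanSpace ℝ (Fin n)

section Kernel

variable {n : ℕ}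

lemma nontrivial_eu (hn : 5 ≤ n) : Nontrivial (Eu n) :=
  Module.nontrivial_of_finrank_pos (R := ℝ) (by simp; omega)

lemma measurable_norm_rpow (s : ℝ) : Measurable (fun z : Eu n => ‖z‖ ^ s) := by fun_prop

lemma integrableOn_ball_norm_rpow (hn : 5 ≤ n) {s : ℝ} (hs : s < n) (r : ℝ) :
    IntegrableOn (fun z : Eu n => ‖z‖ ^ (-s)) (ball 0 r) := by
  refine integrableOn_ball_of_norm_le_rpow (C := 1) (α := s) (by simp; omega) (by simpa using hs) ?_
    (measurable_norm_rpow _).aestronglyMeasurable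
  refine Eventually.of_forall fun x => ?_
  simp [abs_of_nonneg (Real.rpow_nonneg (norm_nonneg x) _)]

lemma integrableOn_compl_ball_norm_rpow {s : ℝ} (hs : n < s) {r : ℝ} (hr : 0 < r) :
    IntegrableOn (fun z : Eu n => ‖z‖ ^ (-s)) (ball 0 r)ᶜ := by
  have hs0 : 0 < s := lt_of_le_of_lt n.cast_nonneg hs
  have h := (integrable_one_add_norm (E := Eu n) (μ := volume) (r := s) (by simpa using hs)).const_mul
    ((1 / r + 1) ^ s)
  refine Integrable.mono' h.integrableOn (measurable_norm_rpow _).aestronglyMeasurable ?_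
  rw [ae_restrict_iff' measurableSet_ball.compl]
  refine Eventually.of_forall fun x hx => ?_
  have hx' : r ≤ ‖x‖ := by simpa using hx
  have hxp : 0 < ‖x‖ := hr.trans_le hx'
  rw [Real.norm_of_nonneg (Real.rpow_nonneg (norm_nonneg x) _), Real.rpow_neg hxp.le,
    Real.rpow_neg (by positivity), ← div_eq_mul_inv, le_div_iff₀ (by positivity),
    inv_mul_eq_div, ← Real.div_rpow (by positivity) hxp.le]
  refine Real.rpow_le_rpow (by positivity) ?_ hs0.le
  rw [div_le_iff₀ hxp]
  have : 1 ≤ 1 / r * ‖x‖ := by rw [one_div, inv_mul_eq_div, le_div_iff₀ hr]; linarith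
  nlinarith

lemma not_integrable_norm_rpow (hn : 5 ≤ n) (s : ℝ) :
    ¬ Integrable (fun z : Eu n => ‖z‖ ^ (-s)) := by
  have := nontrivial_eu hn
  rw [integrable_fun_norm_addHaar (E := Eu n) volume (f := fun t => t ^ (-s))]
  intro h
  refine not_integrableOn_Ioi_rpow ((n : ℝ) - 1 - s) (h.congr_fun ?_ measurableSet_Ioi)
  intro y hy
  have hy : 0 < y := hy
  simp only [finrank_euclideanSpace, Fintype.card_fin, smul_eq_mul]
  rw [← Real.rpow_natCast, ← Real.rpow_add hy, Nat.cast_sub (by omega)]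
  simp; ring_nf

lemma setIntegral_norm_rpow_smul {S : Set (Eu n)} {r : ℝ} (hr : 0 < r) (s : ℝ) :
    ∫ z in r • S, ‖z‖ ^ (-s) = r ^ ((n : ℝ) - s) * ∫ z in S, ‖z‖ ^ (-s) := by
  have h := Measure.setIntegral_comp_smul_of_pos (volume : Measure (Eu n))
    (fun z => ‖z‖ ^ (-s)) S hr
  have h2 : ∀ z : Eu n, ‖r • z‖ ^ (-s) = r ^ (-s) * ‖z‖ ^ (-s) := fun z => by
    rw [norm_smul, Real.norm_of_nonneg hr.le, Real.mul_rpow hr.le (norm_nonneg _)]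
  simp only [h2, integral_const_mul, finrank_euclideanSpace, Fintype.card_fin, smul_eq_mul] at h
  rw [sub_eq_add_neg, Real.rpow_add hr, Real.rpow_natCast, mul_assoc, h, mul_inv_cancel_left₀]
  positivity

lemma smul_ball_zero_one {r : ℝ} (hr : 0 < r) : r • ball (0 : Eu n) 1 = ball 0 r := by
  rw [smul_unitBall_of_pos hr]

/-- The mass of the kernel `|z|^(-s)` on the unit ball. -/
noncomputable def inMass (n : ℕ) (s : ℝ) : ℝ := ∫ z in ball (0 : Eu n) 1, ‖z‖ ^ (-s)

/-- The mass of the kernel `|z|^(-s)` outside of the unit ball. -/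
noncomputable def outMass (n : ℕ) (s : ℝ) : ℝ := ∫ z in (ball (0 : Eu n) 1)ᶜ, ‖z‖ ^ (-s)

lemma inMass_nonneg (s : ℝ) : 0 ≤ inMass n s :=
  integral_nonneg fun _ => Real.rpow_nonneg (norm_nonneg _) _

lemma outMass_nonneg (s : ℝ) : 0 ≤ outMass n s :=
  integral_nonneg fun _ => Real.rpow_nonneg (norm_nonneg _) _

lemma setIntegral_ball_norm_rpow {r : ℝ} (hr : 0 < r) (s : ℝ) :
    ∫ z in ball (0 : Eu n) r, ‖z‖ ^ (-s) = r ^ ((n : ℝ) - s) * inMass n s := by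
  rw [← smul_ball_zero_one hr, setIntegral_norm_rpow_smul hr, inMass]

lemma setIntegral_compl_ball_norm_rpow {r : ℝ} (hr : 0 < r) (s : ℝ) :
    ∫ z in (ball (0 : Eu n) r)ᶜ, ‖z‖ ^ (-s) = r ^ ((n : ℝ) - s) * outMass n s := by
  have h : r • (ball (0 : Eu n) 1)ᶜ = (r • ball (0 : Eu n) 1)ᶜ :=
    Set.image_compl_eq (MulAction.bijective₀ hr.ne')
  rw [← smul_ball_zero_one hr, ← h, setIntegral_norm_rpow_smul hr, outMass]

/-- The Riesz-type kernel `|x - z|^(-s)`. -/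
noncomputable def ker (s : ℝ) (x z : Eu n) : ℝ := ‖x - z‖ ^ (-s)

lemma ker_nonneg (s : ℝ) (x z : Eu n) : 0 ≤ ker s x z := Real.rpow_nonneg (norm_nonneg _) _

@[fun_prop]
lemma measurable_ker (s : ℝ) (x : Eu n) : Measurable (ker s x) := by
  unfold ker; fun_prop

lemma ker_comm (s : ℝ) (x z : Eu n) : ker s x z = ker s z x := by
  rw [ker, ker, norm_sub_rev]

lemma ker_pos {s : ℝ} {x z : Eu n} (h : x ≠ z) : 0 < ker s x z :=
  Real.rpow_pos_of_pos (norm_pos_iff.2 (sub_ne_zero.2 h)) _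

lemma preimage_sub_ball (x : Eu n) (r : ℝ) : (fun z => x - z) ⁻¹' ball 0 r = ball x r := by
  ext z; simp [dist_eq_norm, norm_sub_rev]

lemma integrableOn_ker_ball (hn : 5 ≤ n) {s : ℝ} (hs : s < n) (x : Eu n) (r : ℝ) :
    IntegrableOn (ker s x) (ball x r) := by
  have := (Measure.measurePreserving_sub_left volume x).integrableOn_comp_preimage
    (Homeomorph.subLeft x).measurableEmbedding (f := fun z : Eu n => ‖z‖ ^ (-s)) (s := ball 0 r)
  rw [preimage_sub_ball] at this
  exact this.2 (integrableOn_ball_norm_rpow hn hs r)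

lemma setIntegral_ker_ball {s : ℝ} (x : Eu n) {r : ℝ} (hr : 0 < r) :
    ∫ z in ball x r, ker s x z = r ^ ((n : ℝ) - s) * inMass n s := by
  have := (Measure.measurePreserving_sub_left volume x).setIntegral_preimage_emb
    (Homeomorph.subLeft x).measurableEmbedding (fun z : Eu n => ‖z‖ ^ (-s)) (ball 0 r)
  rw [preimage_sub_ball, setIntegral_ball_norm_rpow hr] at this
  exact this

lemma integrableOn_ker_compl_ball {s : ℝ} (hs : n < s) (x : Eu n) {r : ℝ} (hr : 0 < r) :
    IntegrableOn (ker s x) (ball x r)ᶜ := by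
  have := (Measure.measurePreserving_sub_left volume x).integrableOn_comp_preimage
    (Homeomorph.subLeft x).measurableEmbedding (f := fun z : Eu n => ‖z‖ ^ (-s)) (s := (ball 0 r)ᶜ)
  rw [Set.preimage_compl, preimage_sub_ball] at this
  exact this.2 (integrableOn_compl_ball_norm_rpow hs hr)

lemma setIntegral_ker_compl_ball {s : ℝ} (x : Eu n) {r : ℝ} (hr : 0 < r) :
    ∫ z in (ball x r)ᶜ, ker s x z = r ^ ((n : ℝ) - s) * outMass n s := by
  have := (Measure.measurePreserving_sub_left volume x).setIntegral_preimage_emb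
    (Homeomorph.subLeft x).measurableEmbedding (fun z : Eu n => ‖z‖ ^ (-s)) (ball 0 r)ᶜ
  rw [Set.preimage_compl, preimage_sub_ball, setIntegral_compl_ball_norm_rpow hr] at this
  exact this

lemma not_integrable_ker (hn : 5 ≤ n) (s : ℝ) (x : Eu n) :
    ¬ Integrable (ker s x) := by
  intro h
  refine not_integrable_norm_rpow hn s ?_
  exact ((Measure.measurePreserving_sub_left volume x).integrable_comp_emb
    (Homeomorph.subLeft x).measurableEmbedding (g := fun z : Eu n => ‖z‖ ^ (-s))).1 h

lemma ker_le_of_le {s : ℝ} (hs : 0 ≤ s) {x z : Eu n} {r : ℝ} (hr : 0 < r) (h : r ≤ ‖x - z‖) :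
    ker s x z ≤ r ^ (-s) :=
  Real.rpow_le_rpow_of_nonpos hr h (by linarith)

lemma integrableOn_ker (hn : 5 ≤ n) {s : ℝ} (hs0 : 0 ≤ s) (hs : s < n) (x : Eu n) {S : Set (Eu n)}
    (hS : volume S ≠ ⊤) : IntegrableOn (ker s x) S := by
  have h1 : IntegrableOn (ker s x) (S ∩ ball x 1) :=
    (integrableOn_ker_ball hn hs x 1).mono_set Set.inter_subset_right
  have h2 : IntegrableOn (ker s x) (S ∩ (ball x 1)ᶜ) := by
    refine Measure.integrableOn_of_bounded (M := 1) ?_ (measurable_ker s x).aestronglyMeasurable ?_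
    · exact ((measure_mono Set.inter_subset_left).trans_lt hS.lt_top).ne
    · refine ae_restrict_of_ae_restrict_of_subset Set.inter_subset_right ?_
      rw [ae_restrict_iff' measurableSet_ball.compl]
      refine Eventually.of_forall fun z hz => ?_
      rw [Real.norm_of_nonneg (ker_nonneg _ _ _)]
      simpa using ker_le_of_le hs0 one_pos (by simpa [dist_eq_norm, norm_sub_rev] using hz)
  simpa [Set.inter_union_compl] using h1.union h2

/-- Splitting a set at distance `δ` from the pole controls the mass of the kernel. -/
lemma setIntegral_ker_le (hn : 5 ≤ n) {s : ℝ} (hs0 : 0 ≤ s) (hs : s < n) (x : Eu n)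
    {S : Set (Eu n)} (hSm : MeasurableSet S) (hS : volume S ≠ ⊤) {δ : ℝ} (hδ : 0 < δ) :
    ∫ z in S, ker s x z ≤ δ ^ ((n : ℝ) - s) * inMass n s + δ ^ (-s) * volume.real S := by
  rw [← integral_inter_add_sdiff (measurableSet_ball (x := x) (ε := δ)) (integrableOn_ker hn hs0 hs x hS)]
  refine add_le_add ?_ ?_
  · rw [← setIntegral_ker_ball x hδ]
    exact setIntegral_mono_set (integrableOn_ker_ball hn hs x δ)
      (Eventually.of_forall fun z => ker_nonneg _ _ _) Set.inter_subset_right.eventuallyLE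
  · have h1 : ∫ z in S \ ball x δ, ker s x z ≤ ∫ z in S \ ball x δ, δ ^ (-s) := by
      refine setIntegral_mono_on ((integrableOn_ker hn hs0 hs x hS).mono_set Set.sdiff_subset) ?_
        (hSm.diff measurableSet_ball) ?_
      · exact integrableOn_const ((measure_mono Set.sdiff_subset).trans_lt hS.lt_top).ne
      · intro z hz
        exact ker_le_of_le hs0 hδ (by simpa [dist_eq_norm, norm_sub_rev] using hz.2)
    refine h1.trans ?_
    rw [setIntegral_const, smul_eq_mul, mul_comm]
    exact mul_le_mul_of_nonneg_left (measureReal_mono Set.sdiff_subset hS)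
      (Real.rpow_nonneg hδ.le _)

lemma mul_rpow_neg_le {a b s t : ℝ} (ha : 0 < a) (hb : 0 < b) (hs : 0 ≤ s) (ht : 0 ≤ t) :
    a ^ (-s) * b ^ (-t) ≤ a ^ (-(s + t)) + b ^ (-(s + t)) := by
  have key : ∀ c : ℝ, 0 < c → c ^ (-s) * c ^ (-t) = c ^ (-(s + t)) := fun c hc => by
    rw [← Real.rpow_add hc]; ring_nf
  rcases le_total a b with h | h
  · have : b ^ (-t) ≤ a ^ (-t) := Real.rpow_le_rpow_of_nonpos ha h (by linarith)
    have h2 : a ^ (-s) * b ^ (-t) ≤ a ^ (-s) * a ^ (-t) := by gcongr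
    rw [key a ha] at h2
    linarith [Real.rpow_nonneg hb.le (-(s + t))]
  · have : a ^ (-s) ≤ b ^ (-s) := Real.rpow_le_rpow_of_nonpos hb h (by linarith)
    have h2 : a ^ (-s) * b ^ (-t) ≤ b ^ (-s) * b ^ (-t) := by gcongr
    rw [key b hb] at h2
    linarith [Real.rpow_nonneg ha.le (-(s + t))]

/-- The constant bounding the convolution of `|z|^(-s)` with the tail of `|z|^(-t)`. -/
noncomputable def tailConst (n : ℕ) (s t : ℝ) : ℝ := inMass n s + 2 * outMass n (s + t)

lemma tailConst_nonneg (s t : ℝ) : 0 ≤ tailConst n s t := by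
  have := inMass_nonneg (n := n) s
  have := outMass_nonneg (n := n) (s + t)
  unfold tailConst; positivity

lemma integrableOn_ker_mul_tail (hn : 5 ≤ n) {s t : ℝ} (hs0 : 0 ≤ s) (hs : s < n) (ht : 0 ≤ t)
    (hst : n < s + t) (x : Eu n) {R : ℝ} (hR : 0 < R) :
    IntegrableOn (fun z => ker s x z * ‖z‖ ^ (-t)) (ball 0 R)ᶜ ∧
    ∫ z in (ball 0 R)ᶜ, ker s x z * ‖z‖ ^ (-t) ≤ tailConst n s t * R ^ ((n : ℝ) - s - t) := by
  set f : Eu n → ℝ := fun z => (ball x R).indicator (fun z => R ^ (-t) * ker s x z) z +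
    ((ball x R)ᶜ.indicator (ker (s + t) x) z + ‖z‖ ^ (-(s + t))) with hf
  have i1 : Integrable ((ball x R).indicator (fun z => R ^ (-t) * ker s x z)) :=
    (integrable_indicator_iff measurableSet_ball).2 ((integrableOn_ker_ball hn hs x R).const_mul _)
  have i2 : Integrable ((ball x R)ᶜ.indicator (ker (s + t) x)) :=
    (integrable_indicator_iff measurableSet_ball.compl).2 (integrableOn_ker_compl_ball hst x hR)
  have i3 : IntegrableOn (fun z : Eu n => ‖z‖ ^ (-(s + t))) (ball 0 R)ᶜ :=
    integrableOn_compl_ball_norm_rpow hst hR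
  have hfi : IntegrableOn f (ball 0 R)ᶜ := i1.integrableOn.add (i2.integrableOn.add i3)
  have hle : ∀ z ∈ (ball (0 : Eu n) R)ᶜ, ker s x z * ‖z‖ ^ (-t) ≤ f z := by
    intro z hz
    have hz' : R ≤ ‖z‖ := by simpa using hz
    have hz0 : 0 < ‖z‖ := hR.trans_le hz'
    have p1 := Real.rpow_nonneg hz0.le (-(s + t))
    by_cases hx : z ∈ ball x R
    · have hx' : z ∉ (ball x R)ᶜ := fun h => h hx
      simp only [hf, Set.indicator_of_mem hx, Set.indicator_of_notMem hx']
      have : ‖z‖ ^ (-t) ≤ R ^ (-t) := Real.rpow_le_rpow_of_nonpos hR hz' (by linarith)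
      have := mul_le_mul_of_nonneg_left this (ker_nonneg s x z)
      linarith
    · have hx' : z ∈ (ball x R)ᶜ := hx
      simp only [hf, Set.indicator_of_notMem hx, Set.indicator_of_mem hx', zero_add]
      have hd : R ≤ ‖x - z‖ := by simpa [dist_eq_norm, norm_sub_rev] using hx
      exact mul_rpow_neg_le (hR.trans_le hd) hz0 hs0 ht
  have hgi : IntegrableOn (fun z => ker s x z * ‖z‖ ^ (-t)) (ball 0 R)ᶜ := by
    refine Integrable.mono' hfi (by fun_prop) ?_
    rw [ae_restrict_iff' measurableSet_ball.compl]
    refine Eventually.of_forall fun z hz => ?_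
    rw [Real.norm_of_nonneg (mul_nonneg (ker_nonneg _ _ _) (Real.rpow_nonneg (norm_nonneg _) _))]
    exact hle z hz
  refine ⟨hgi, (setIntegral_mono_on hgi hfi measurableSet_ball.compl hle).trans ?_⟩
  have e1 : ∫ z in (ball (0 : Eu n) R)ᶜ, (ball x R).indicator (fun z => R ^ (-t) * ker s x z) z ≤
      R ^ (-t) * (R ^ ((n : ℝ) - s) * inMass n s) := by
    rw [← setIntegral_ker_ball x hR, ← integral_const_mul, ← integral_indicator measurableSet_ball]
    refine setIntegral_le_integral i1 (Eventually.of_forall fun z => ?_)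
    exact Set.indicator_nonneg (fun z _ => mul_nonneg (Real.rpow_nonneg hR.le _) (ker_nonneg _ _ _)) z
  have e2 : ∫ z in (ball (0 : Eu n) R)ᶜ, (ball x R)ᶜ.indicator (ker (s + t) x) z ≤
      R ^ ((n : ℝ) - (s + t)) * outMass n (s + t) := by
    rw [← setIntegral_ker_compl_ball x hR,
      ← integral_indicator (measurableSet_ball (x := x) (ε := R)).compl]
    refine setIntegral_le_integral i2 (Eventually.of_forall fun z => ?_)
    exact Set.indicator_nonneg (fun z _ => (ker_nonneg _ _ _)) z
  have e0 : ∫ z in (ball (0 : Eu n) R)ᶜ, f z = _ :=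
    (integral_add i1.integrableOn (i2.integrableOn.add i3)).trans
      (congrArg _ (integral_add i2.integrableOn i3))
  rw [e0, setIntegral_compl_ball_norm_rpow hR]
  have e3 : R ^ (-t) * (R ^ ((n : ℝ) - s) * inMass n s) = R ^ ((n : ℝ) - s - t) * inMass n s := by
    rw [← mul_assoc, ← Real.rpow_add hR]; ring_nf
  have e4 : (n : ℝ) - (s + t) = n - s - t := by ring
  rw [e3] at e1
  rw [e4] at e2 ⊢
  unfold tailConst
  linarith

end Kernel

section Operators

variable {n : ℕ}

/-- The `i`-th standard basis vector. -/
noncomputable abbrev bv (i : Fin n) : Eu n := EuclideanSpace.single i 1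

lemma lap_congr {u w : Eu n → ℝ} {x : Eu n} (h : u =ᶠ[𝓝 x] w) : lap u x = lap w x := by
  unfold lap
  rw [(h.iteratedFDeriv ℝ 2).eq_of_nhds]

lemma lap_congr_nhds {u w : Eu n → ℝ} {x : Eu n} (h : u =ᶠ[𝓝 x] w) : lap u =ᶠ[𝓝 x] lap w := by
  filter_upwards [eventually_eventually_nhds.2 h] with y hy
  exact lap_congr hy

lemma bilap_congr {u w : Eu n → ℝ} {x : Eu n} (h : u =ᶠ[𝓝 x] w) : bilap u x = bilap w x :=
  lap_congr (lap_congr_nhds h)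

lemma contDiffAt_lap {u : Eu n → ℝ} {x : Eu n} {k m : WithTop ℕ∞} (h : ContDiffAt ℝ m u x)
    (hk : k + 2 ≤ m) : ContDiffAt ℝ k (lap u) x := by
  unfold lap
  refine ContDiffAt.sum fun i _ => ?_
  have h2 := h.iteratedFDeriv_right (m := k) (i := 2) (by exact_mod_cast hk)
  exact (ContinuousMultilinearMap.apply ℝ (fun _ : Fin 2 => Eu n) ℝ
    ![EuclideanSpace.single i 1, EuclideanSpace.single i 1]).contDiff.contDiffAt.comp x h2

lemma lap_apply (u : Eu n → ℝ) (x : Eu n) :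
    lap u x = ∑ i, fderiv ℝ (fderiv ℝ u) x (bv i) (bv i) := by
  simp [lap, iteratedFDeriv_two_apply]

lemma lap_eq_sum {u : Eu n → ℝ} {x : Eu n} (h : ContDiffAt ℝ 2 u x) :
    lap u x = ∑ i, fderiv ℝ (fun y => fderiv ℝ u y (bv i)) x (bv i) := by
  rw [lap_apply]
  refine Finset.sum_congr rfl fun i _ => ?_
  have hd : DifferentiableAt ℝ (fderiv ℝ u) x :=
    (h.fderiv_right (m := 1) (by norm_num)).differentiableAt (by norm_num)
  rw [fderiv_clm_apply hd (differentiableAt_const _)]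
  simp

lemma lap_comp_affine (u : Eu n → ℝ) (x₀ : Eu n) (s : ℝ) (x : Eu n) :
    lap (fun x => u (x₀ + s • x)) x = s ^ 2 * lap u (x₀ + s • x) := by
  have h1 : fderiv ℝ (fun x => u (x₀ + s • x)) = fun x => s • fderiv ℝ u (x₀ + s • x) := by
    ext1 x
    have := fderiv_comp_smul (𝕜 := ℝ) (f := fun z => u (x₀ + z)) (x := x) s
    rw [this, fderiv_comp_add_left]
  rw [lap_apply, lap_apply, h1, Finset.mul_sum]
  refine Finset.sum_congr rfl fun i _ => ?_
  have h2 : fderiv ℝ (fun x => s • fderiv ℝ u (x₀ + s • x)) x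
      = s • s • fderiv ℝ (fderiv ℝ u) (x₀ + s • x) := by
    have e := congrFun (fderiv_const_smul_field (𝕜 := ℝ) s (f := fun x => fderiv ℝ u (x₀ + s • x))) x
    have := fderiv_comp_smul (𝕜 := ℝ) (f := fun z => fderiv ℝ u (x₀ + z)) (x := x) s
    rw [fderiv_comp_add_left] at this
    rw [← this]
    exact e
  rw [h2]
  simp; ring

lemma lap_const_mul (u : Eu n → ℝ) (c : ℝ) (x : Eu n) :
    lap (fun x => c * u x) x = c * lap u x := by
  have h1 : fderiv ℝ (fun x => c * u x) = fun x => c • fderiv ℝ u x := by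
    ext1 x
    exact congrFun (fderiv_const_smul_field (𝕜 := ℝ) c (f := u)) x
  rw [lap_apply, lap_apply, h1, Finset.mul_sum]
  refine Finset.sum_congr rfl fun i _ => ?_
  have h2 : fderiv ℝ (fun x => c • fderiv ℝ u x) x = c • fderiv ℝ (fderiv ℝ u) x :=
    congrFun (fderiv_const_smul_field (𝕜 := ℝ) c (f := fderiv ℝ u)) x
  rw [h2]; rfl

lemma lap_add {u w : Eu n → ℝ} {x : Eu n} (hu : ContDiffAt ℝ 2 u x) (hw : ContDiffAt ℝ 2 w x) :
    lap (fun x => u x + w x) x = lap u x + lap w x := by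
  unfold lap
  rw [← Finset.sum_add_distrib]
  refine Finset.sum_congr rfl fun i _ => ?_
  have := iteratedFDeriv_add_apply (𝕜 := ℝ) (i := 2) (x := x) (f := u) (g := w)
    (by exact_mod_cast hu) (by exact_mod_cast hw)
  have h2 : (fun x => u x + w x) = u + w := rfl
  rw [h2, this]; rfl

lemma bilap_comp_affine (u : Eu n → ℝ) (x₀ : Eu n) (s : ℝ) (x : Eu n) :
    bilap (fun x => u (x₀ + s • x)) x = s ^ 4 * bilap u (x₀ + s • x) := by
  have h : lap (fun x => u (x₀ + s • x)) = fun x => s ^ 2 * lap u (x₀ + s • x) :=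
    funext (lap_comp_affine u x₀ s)
  rw [bilap, h, lap_const_mul _ (s ^ 2), lap_comp_affine, bilap]; ring

lemma bilap_const_mul (u : Eu n → ℝ) (c : ℝ) (x : Eu n) :
    bilap (fun x => c * u x) x = c * bilap u x := by
  have h : lap (fun x => c * u x) = fun x => c * lap u x := funext (lap_const_mul u c)
  rw [bilap, h, lap_const_mul, bilap]

lemma contDiff_lap {u : Eu n → ℝ} {k m : WithTop ℕ∞} (h : ContDiff ℝ m u)
    (hk : k + 2 ≤ m) : ContDiff ℝ k (lap u) :=
  contDiff_iff_contDiffAt.2 fun _ => contDiffAt_lap h.contDiffAt hk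

lemma lap_of_notMem_tsupport {g : Eu n → ℝ} {x : Eu n} (h : x ∉ tsupport g) : lap g x = 0 := by
  rw [notMem_tsupport_iff_eventuallyEq] at h
  rw [lap_congr h, lap_apply]
  simp

lemma hasCompactSupport_lap {g : Eu n → ℝ} (h : HasCompactSupport g) :
    HasCompactSupport (lap g) :=
  HasCompactSupport.intro h fun _ hx => lap_of_notMem_tsupport hx

lemma integral_mul_fderiv_eq_neg {f g : Eu n → ℝ} (hf : ContDiff ℝ 1 f) (hg : ContDiff ℝ 1 g)
    (hs : HasCompactSupport g) (v : Eu n) :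
    ∫ x, f x * fderiv ℝ g x v = - ∫ x, fderiv ℝ f x v * g x := by
  have cf : Continuous fun x => fderiv ℝ f x v :=
    (hf.continuous_fderiv (by norm_num)).clm_apply continuous_const
  have cg : Continuous fun x => fderiv ℝ g x v :=
    (hg.continuous_fderiv (by norm_num)).clm_apply continuous_const
  refine integral_mul_fderiv_eq_neg_fderiv_mul_of_integrable ?_ ?_ ?_
    (fun x _ => hf.differentiable (by norm_num) x) (fun x _ => hg.differentiable (by norm_num) x)
  · exact (cf.mul hg.continuous).integrable_of_hasCompactSupport hs.mul_left
  · exact (hf.continuous.mul cg).integrable_of_hasCompactSupport (hs.fderiv_apply ℝ v).mul_left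
  · exact (hf.continuous.mul hg.continuous).integrable_of_hasCompactSupport hs.mul_left

lemma contDiff_fderiv_apply {f : Eu n → ℝ} (hf : ContDiff ℝ 2 f) (v : Eu n) :
    ContDiff ℝ 1 fun x => fderiv ℝ f x v :=
  (hf.fderiv_right (m := 1) (by norm_num)).clm_apply contDiff_const

lemma integral_mul_lap {f g : Eu n → ℝ} (hf : ContDiff ℝ 2 f) (hg : ContDiff ℝ 2 g)
    (hs : HasCompactSupport g) : ∫ x, f x * lap g x = ∫ x, lap f x * g x := by
  have h1 : ∀ x, f x * lap g x = ∑ i, f x * fderiv ℝ (fun y => fderiv ℝ g y (bv i)) x (bv i) :=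
    fun x => by rw [lap_eq_sum hg.contDiffAt, Finset.mul_sum]
  have h2 : ∀ x, lap f x * g x = ∑ i, fderiv ℝ (fun y => fderiv ℝ f y (bv i)) x (bv i) * g x :=
    fun x => by rw [lap_eq_sum hf.contDiffAt, Finset.sum_mul]
  simp only [h1, h2]
  have c2 : ∀ {h : Eu n → ℝ}, ContDiff ℝ 2 h → ∀ i : Fin n,
      Continuous fun x => fderiv ℝ (fun y => fderiv ℝ h y (bv i)) x (bv i) := fun hh i =>
    ((contDiff_fderiv_apply hh (bv i)).continuous_fderiv (by norm_num)).clm_apply continuous_const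
  rw [integral_finsetSum, integral_finsetSum]
  · refine Finset.sum_congr rfl fun i _ => ?_
    rw [integral_mul_fderiv_eq_neg (hf.of_le (by norm_num)) (contDiff_fderiv_apply hg _)
      (hs.fderiv_apply ℝ _), integral_mul_fderiv_eq_neg (contDiff_fderiv_apply hf _)
      (hg.of_le (by norm_num)) hs, neg_neg]
  · intro i _
    exact ((c2 hf i).mul hg.continuous).integrable_of_hasCompactSupport hs.mul_left
  · intro i _
    exact (hf.continuous.mul (c2 hg i)).integrable_of_hasCompactSupport
      ((hs.fderiv_apply ℝ _).fderiv_apply ℝ _).mul_left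

lemma integral_mul_bilap {f g : Eu n → ℝ} (hf : ContDiff ℝ 4 f) (hg : ContDiff ℝ 4 g)
    (hs : HasCompactSupport g) : ∫ x, f x * bilap g x = ∫ x, bilap f x * g x := by
  have lf := contDiff_lap (k := 2) hf (by norm_num)
  have lg := contDiff_lap (k := 2) hg (by norm_num)
  rw [bilap, integral_mul_lap (hf.of_le (by norm_num)) lg (hasCompactSupport_lap hs),
    integral_mul_lap lf (hg.of_le (by norm_num)) hs]
  rfl

end Operators

section Bubble

variable {n : ℕ}

/-- The regularised kernel `(a + |x - y|²)^s`. -/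
noncomputable def reg (a s : ℝ) (x y : Eu n) : ℝ := (a + ‖x - y‖ ^ 2) ^ s

lemma hasFDerivAt_reg {a : ℝ} (ha : 0 < a) (s : ℝ) (x y : Eu n) :
    HasFDerivAt (reg a s x) ((2 * s * reg a (s - 1) x y) • innerSL ℝ (y - x)) y := by
  have h0 : HasFDerivAt (fun y : Eu n => x - y) (-ContinuousLinearMap.id ℝ (Eu n)) y := by
    simpa using (hasFDerivAt_id y).const_sub x
  have h1 := (h0.norm_sq.const_add a).rpow_const (p := s)
    (Or.inl (ne_of_gt (by positivity)))
  refine h1.congr_fderiv ?_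
  ext v
  simp [reg]
  ring

lemma contDiff_reg {a : ℝ} (ha : 0 < a) (s : ℝ) (x : Eu n) {k : WithTop ℕ∞} :
    ContDiff ℝ k (reg a s x) := by
  refine contDiff_iff_contDiffAt.2 fun y => ?_
  unfold reg
  refine ContDiffAt.rpow_const_of_ne ?_ (ne_of_gt (by positivity))
  exact contDiffAt_const.add ((contDiffAt_const.sub contDiffAt_id).norm_sq ℝ)

lemma lap_reg {a : ℝ} (ha : 0 < a) (s : ℝ) (x y : Eu n) :
    lap (reg a s x) y = 2 * s * (n + 2 * s - 2) * reg a (s - 1) x y +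
      -4 * s * (s - 1) * a * reg a (s - 2) x y := by
  have hq : 0 < a + ‖x - y‖ ^ 2 := by positivity
  rw [lap_eq_sum (contDiff_reg ha s x).contDiffAt]
  have h1 : ∀ i : Fin n, fderiv ℝ (fun y => fderiv ℝ (reg a s x) y (bv i)) y (bv i) =
      2 * s * (2 * (s - 1) * reg a (s - 2) x y) * (y i - x i) ^ 2 +
      2 * s * reg a (s - 1) x y := by
    intro i
    have e : (fun y => fderiv ℝ (reg a s x) y (bv i)) =
        fun y => 2 * s * (reg a (s - 1) x y * (y i - x i)) := by
      ext y
      rw [(hasFDerivAt_reg ha s x y).fderiv]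
      simp [EuclideanSpace.inner_single_right]; ring
    rw [e]
    have hc : HasFDerivAt (fun y : Eu n => y i - x i) (EuclideanSpace.proj i : Eu n →L[ℝ] ℝ) y :=
      (EuclideanSpace.proj i : Eu n →L[ℝ] ℝ).hasFDerivAt.sub_const (x i)
    have hd : HasFDerivAt (fun y : Eu n => 2 * s * (reg a (s - 1) x y * (y i - x i))) _ y :=
      ((hasFDerivAt_reg ha (s - 1) x y).mul hc).const_mul (2 * s)
    rw [hd.fderiv]
    have : s - 1 - 1 = s - 2 := by ring
    simp [EuclideanSpace.inner_single_right, this]; ring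
  simp only [h1]
  rw [Finset.sum_add_distrib, ← Finset.mul_sum]
  have h2 : ∑ i, (y i - x i) ^ 2 = ‖x - y‖ ^ 2 := by
    rw [norm_sub_rev, EuclideanSpace.norm_sq_eq]; simp
  have h3 : reg a (s - 1) x y = (a + ‖x - y‖ ^ 2) * reg a (s - 2) x y := by
    unfold reg
    rw [mul_comm, ← Real.rpow_add_one hq.ne']; ring_nf
  rw [h2, h3]
  simp; ring

lemma bilap_reg {a : ℝ} (ha : 0 < a) (s : ℝ) (hs : s = (4 - n) / 2) (x y : Eu n) :
    bilap (reg a s x) y = 16 * s * (s - 1) * (s - 2) * (s - 3) * a ^ 2 * reg a (s - 4) x y := by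
  have h : lap (reg a s x) = fun y => 2 * s * (n + 2 * s - 2) * reg a (s - 1) x y +
      -4 * s * (s - 1) * a * reg a (s - 2) x y := funext (lap_reg ha s x)
  rw [bilap, h, lap_add, lap_const_mul _ (2 * s * (n + 2 * s - 2)),
    lap_const_mul _ (-4 * s * (s - 1) * a), lap_reg ha, lap_reg ha]
  · have hn : (n : ℝ) = 4 - 2 * s := by rw [hs]; ring
    have e1 : s - 1 - 1 = s - 2 := by ring
    have e2 : s - 1 - 2 = s - 3 := by ring
    have e3 : s - 2 - 1 = s - 3 := by ring
    have e4 : s - 2 - 2 = s - 4 := by ring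
    rw [e1, e2, e3, e4, hn]; ring
  · exact contDiffAt_const.mul (contDiff_reg ha _ x).contDiffAt
  · exact contDiffAt_const.mul (contDiff_reg ha _ x).contDiffAt

end Bubble

section Commutator

variable {n : ℕ}

/-- The embedding of the last factor of `ℝ × ℝⁿ × ℝⁿ`. -/
noncomputable abbrev lastIncl (n : ℕ) : Eu n →L[ℝ] ℝ × Eu n × Eu n :=
  (ContinuousLinearMap.inr ℝ ℝ (Eu n × Eu n)).comp (ContinuousLinearMap.inr ℝ (Eu n) (Eu n))

/-- The Laplacian in the last variable of a function on `ℝ × ℝⁿ × ℝⁿ`. -/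
noncomputable def lapLast (F : ℝ × Eu n × Eu n → ℝ) (q : ℝ × Eu n × Eu n) : ℝ :=
  ∑ i, fderiv ℝ (fderiv ℝ F) q (lastIncl n (bv i)) (lastIncl n (bv i))

lemma contDiffAt_lapLast {F : ℝ × Eu n × Eu n → ℝ} {q : ℝ × Eu n × Eu n}
    (h : ContDiffAt ℝ ∞ F q) : ContDiffAt ℝ ∞ (lapLast F) q := by
  unfold lapLast
  refine ContDiffAt.sum fun i _ => ?_
  have h1 : ContDiffAt ℝ ∞ (fderiv ℝ (fderiv ℝ F)) q :=
    (h.fderiv_right (m := ∞) (by simp)).fderiv_right (m := ∞) (by simp)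
  exact (h1.clm_apply contDiffAt_const).clm_apply contDiffAt_const

lemma lap_slice {F : ℝ × Eu n × Eu n → ℝ} {a : ℝ} {x y : Eu n}
    (h : ContDiffAt ℝ ∞ F (a, x, y)) : lap (fun y => F (a, x, y)) y = lapLast F (a, x, y) := by
  have hι : ∀ y : Eu n, HasFDerivAt (fun y : Eu n => (a, x, y)) (lastIncl n) y := fun y => by
    have := (hasFDerivAt_const (𝕜 := ℝ) a y).prodMk
      ((hasFDerivAt_const (𝕜 := ℝ) x y).prodMk (hasFDerivAt_id (𝕜 := ℝ) y))
    refine this.congr_fderiv ?_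
    ext v <;> simp
  have hev : ∀ᶠ y' in 𝓝 y, ContDiffAt ℝ 1 F (a, x, y') :=
    (hι y).continuousAt.eventually ((h.of_le (m := 1) (by exact_mod_cast le_top)).eventually (by simp))
  have h1 : fderiv ℝ (fun y => F (a, x, y)) =ᶠ[𝓝 y]
      fun y => (fderiv ℝ F (a, x, y)).comp (lastIncl n) := by
    filter_upwards [hev] with y' hy'
    exact ((hy'.differentiableAt (by norm_num)).hasFDerivAt.comp y' (hι y')).fderiv
  have h2 : DifferentiableAt ℝ (fderiv ℝ F) (a, x, y) :=
    (h.fderiv_right (m := ∞) (by simp)).differentiableAt (by simp)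
  rw [lap_apply, lapLast]
  refine Finset.sum_congr rfl fun i _ => ?_
  rw [h1.fderiv_eq]
  have h3 : HasFDerivAt (fun y => (fderiv ℝ F (a, x, y)).comp (lastIncl n)) _ y :=
    (h2.hasFDerivAt.comp y (hι y)).clm_comp (hasFDerivAt_const (lastIncl n) y)
  rw [h3.fderiv]
  simp

lemma bilap_slice {F : ℝ × Eu n × Eu n → ℝ} {a : ℝ} {x y : Eu n}
    (h : ∀ᶠ y' in 𝓝 y, ContDiffAt ℝ ∞ F (a, x, y')) :
    bilap (fun y => F (a, x, y)) y = lapLast (lapLast F) (a, x, y) := by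
  have h1 : lap (fun y => F (a, x, y)) =ᶠ[𝓝 y] fun y => lapLast F (a, x, y) := by
    filter_upwards [h] with y' hy' using lap_slice hy'
  rw [bilap, lap_congr h1, lap_slice (contDiffAt_lapLast h.self_of_nhds)]

/-- Uniform bounds for the biharmonic operator applied to a cut-off of the regularised kernel,
in the region where the cut-off varies. -/
lemma exists_commutator_bound {η : Eu n → ℝ} (hη : ContDiff ℝ ∞ η) (s : ℝ) :
    ∃ K : ℝ, 0 ≤ K ∧ ∀ a ∈ Set.Ioc (0 : ℝ) 1, ∀ y : Eu n, 1 ≤ ‖y‖ → ‖y‖ ≤ 2 →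
      ∀ x ∈ closedBall (0 : Eu n) (1 / 2), ∀ x' ∈ closedBall (0 : Eu n) (1 / 2),
        |bilap (fun y => η y * reg a s x y) y| ≤ K ∧
        |bilap (fun y => η y * reg a s x y) y - bilap (fun y => η y * reg a s x' y) y|
          ≤ K * ‖x - x'‖ := by
  set F : ℝ × Eu n × Eu n → ℝ := fun q => η q.2.2 * (q.1 + ‖q.2.1 - q.2.2‖ ^ 2) ^ s with hF
  set D := lapLast (lapLast F) with hD
  have hFs : ∀ q : ℝ × Eu n × Eu n, 0 < q.1 + ‖q.2.1 - q.2.2‖ ^ 2 → ContDiffAt ℝ ∞ F q := by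
    intro q hq
    refine (hη.contDiffAt.comp q (contDiffAt_snd.snd)).mul
      (ContDiffAt.rpow_const_of_ne ?_ hq.ne')
    exact contDiffAt_fst.add ((contDiffAt_snd.fst.sub contDiffAt_snd.snd).norm_sq ℝ)
  have hDs : ∀ q : ℝ × Eu n × Eu n, 0 < q.1 + ‖q.2.1 - q.2.2‖ ^ 2 → ContDiffAt ℝ ∞ D q :=
    fun q hq => contDiffAt_lapLast (contDiffAt_lapLast (hFs q hq))
  set C : Set (ℝ × Eu n × Eu n) := Set.Icc 0 1 ×ˢ closedBall 0 (1 / 2) ×ˢ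
    (closedBall 0 2 \ ball 0 1) with hC
  have hCc : IsCompact C := isCompact_Icc.prod ((isCompact_closedBall _ _).prod
    ((isCompact_closedBall _ _).diff isOpen_ball))
  have hpos : ∀ q ∈ C, 0 < q.1 + ‖q.2.1 - q.2.2‖ ^ 2 := by
    rintro ⟨a, x, y⟩ ⟨ha, hx, hy⟩
    have h1 : ‖x‖ ≤ 1 / 2 := by simpa using hx
    have h2 : 1 ≤ ‖y‖ := by simpa using hy.2
    have h3 : ‖y‖ ≤ ‖x‖ + ‖x - y‖ := by
      have := norm_sub_le x (x - y)
      simpa using this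
    have h4 : 0 < ‖x - y‖ := by linarith
    have := ha.1
    simp only at this ⊢
    positivity
  obtain ⟨K1, hK1⟩ := hCc.exists_bound_of_continuousOn (f := D)
    fun q hq => (hDs q (hpos q hq)).continuousAt.continuousWithinAt
  obtain ⟨K2, hK2⟩ := hCc.exists_bound_of_continuousOn (f := fderiv ℝ D)
    fun q hq => ((hDs q (hpos q hq)).fderiv_right (m := ∞)
      (by simp)).continuousAt.continuousWithinAt
  refine ⟨max 0 (max K1 K2), le_max_left _ _, ?_⟩
  intro a ha y hy1 hy2 x hx x' hx'
  have hmem : ∀ x ∈ closedBall (0 : Eu n) (1 / 2), ((a, x, y) : ℝ × Eu n × Eu n) ∈ C := fun x hx =>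
    ⟨⟨ha.1.le, ha.2⟩, hx, ⟨by simpa using hy2, by simpa using hy1⟩⟩
  have heq : ∀ x, bilap (fun y => η y * reg a s x y) y = D (a, x, y) := fun x => by
    refine bilap_slice (F := F) (Eventually.of_forall fun y' => hFs _ ?_)
    have := ha.1
    simp only
    positivity
  rw [heq, heq]
  refine ⟨(hK1 _ (hmem x hx)).trans (by simp), ?_⟩
  have hdiff : ∀ z ∈ closedBall (0 : Eu n) (1 / 2), HasFDerivWithinAt (fun x => D (a, x, y))
      ((fderiv ℝ D (a, z, y)).comp ((ContinuousLinearMap.inr ℝ ℝ (Eu n × Eu n)).comp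
        (ContinuousLinearMap.inl ℝ (Eu n) (Eu n)))) (closedBall 0 (1 / 2)) z := by
    intro z hz
    have h1 := ((hDs _ (hpos _ (hmem z hz))).differentiableAt (by simp)).hasFDerivAt
    have h2 : HasFDerivAt (fun z : Eu n => ((a, z, y) : ℝ × Eu n × Eu n))
        ((ContinuousLinearMap.inr ℝ ℝ (Eu n × Eu n)).comp
        (ContinuousLinearMap.inl ℝ (Eu n) (Eu n))) z := by
      refine ((hasFDerivAt_const a z).prodMk ((hasFDerivAt_id z).prodMk
        (hasFDerivAt_const y z))).congr_fderiv ?_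
      ext v <;> simp
    exact (h1.comp z h2).hasFDerivWithinAt
  have hmv := (convex_closedBall (0 : Eu n) (1 / 2)).norm_image_sub_le_of_norm_hasFDerivWithin_le
    (C := max 0 (max K1 K2)) hdiff ?_ hx' hx
  · exact hmv
  · intro z hz
    refine ContinuousLinearMap.opNorm_le_bound _ (le_max_left _ _) fun v => ?_
    have h3 := (fderiv ℝ D (a, z, y)).le_opNorm (0, v, 0)
    have h4 : ‖((0, v, 0) : ℝ × Eu n × Eu n)‖ = ‖v‖ := by simp [Prod.norm_def]
    rw [h4] at h3
    have h5 : ‖fderiv ℝ D (a, z, y)‖ ≤ max 0 (max K1 K2) := (hK2 _ (hmem z hz)).trans (by simp)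
    have h6 := mul_le_mul_of_nonneg_right h5 (norm_nonneg v)
    simpa using h3.trans h6

end Commutator

section Representation

variable {n : ℕ}

/-- A smooth cut-off equal to `1` on the unit ball and supported in the ball of radius `2`. -/
noncomputable def cut (n : ℕ) : ContDiffBump (0 : Eu n) := ⟨1, 2, one_pos, one_lt_two⟩

lemma cut_eq_one {y : Eu n} (h : ‖y‖ ≤ 1) : cut n y = 1 :=
  (cut n).one_of_mem_closedBall (by simpa [cut] using h)

lemma cut_eq_zero {y : Eu n} (h : 2 ≤ ‖y‖) : cut n y = 0 :=
  (cut n).zero_of_le_dist (by simpa [cut] using h)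

lemma reg_le_ker {a : ℝ} (ha : 0 < a) {x y : Eu n} (hn : 5 ≤ n) (hxy : x ≠ y) :
    reg a ((4 - n) / 2) x y ≤ ker (n - 4) x y := by
  have h0 : 0 < ‖x - y‖ := by simpa [sub_eq_zero] using hxy
  have hn' : (5 : ℝ) ≤ n := by exact_mod_cast hn
  have h1 : ker ((n : ℝ) - 4) x y = (‖x - y‖ ^ 2) ^ ((4 - (n : ℝ)) / 2) := by
    rw [ker, ← Real.rpow_natCast, ← Real.rpow_mul h0.le]
    congr 1
    push_cast
    ring
  rw [h1, reg]
  exact Real.rpow_le_rpow_of_nonpos (by positivity) (by linarith) (by linarith)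

lemma reg_nonneg {a : ℝ} (ha : 0 < a) (s : ℝ) (x y : Eu n) : 0 ≤ reg a s x y := by
  unfold reg; positivity

lemma tendsto_reg {a : ℕ → ℝ} (ha : Tendsto a atTop (𝓝 0)) {x y : Eu n} (hxy : x ≠ y) :
    Tendsto (fun k => reg (a k) ((4 - n) / 2) x y) atTop (𝓝 (ker (n - 4) x y)) := by
  have h0 : 0 < ‖x - y‖ := by simpa [sub_eq_zero] using hxy
  have h1 : ker ((n : ℝ) - 4) x y = (0 + ‖x - y‖ ^ 2) ^ ((4 - (n : ℝ)) / 2) := by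
    rw [ker, zero_add, ← Real.rpow_natCast, ← Real.rpow_mul h0.le]
    congr 1
    push_cast
    ring
  rw [h1]
  exact (ha.add_const _).rpow_const (Or.inl (by positivity))

lemma tendsto_integral_reg (hn : 5 ≤ n) {a : ℕ → ℝ} (ha0 : ∀ k, 0 < a k)
    (ha : Tendsto a atTop (𝓝 0)) {f : Eu n → ℝ} (hf : Continuous f) (x : Eu n) :
    Tendsto (fun k => ∫ y, cut n y * reg (a k) ((4 - n) / 2) x y * f y) atTop
      (𝓝 (∫ y, cut n y * ker (n - 4) x y * f y)) := by
  have := nontrivial_eu hn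
  have hn' : (5 : ℝ) ≤ n := by exact_mod_cast hn
  obtain ⟨B, hB⟩ := (isCompact_closedBall (0 : Eu n) 2).exists_bound_of_continuousOn hf.continuousOn
  refine tendsto_integral_of_dominated_convergence
    ((closedBall (0 : Eu n) 2).indicator fun y => B * ker (n - 4) x y) ?_ ?_ ?_ ?_
  · intro k
    have h1 : Continuous (reg (a k) ((4 - n) / 2) x) :=
      (contDiff_reg (ha0 k) _ x (k := 0)).continuous
    exact (((cut n).continuous.mul h1).mul hf).aestronglyMeasurable
  · rw [integrable_indicator_iff measurableSet_closedBall]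
    exact (integrableOn_ker hn (by linarith) (by linarith) x
      measure_closedBall_lt_top.ne).const_mul B
  · intro k
    filter_upwards [compl_mem_ae_iff.2 (measure_singleton x)] with y hy
    have hxy : x ≠ y := fun h => hy (by simp [h])
    by_cases hy2 : y ∈ closedBall (0 : Eu n) 2
    · rw [Set.indicator_of_mem hy2]
      have h1 := reg_le_ker (ha0 k) hn hxy
      have h2 := reg_nonneg (ha0 k) ((4 - n) / 2) x y
      have h3 := hB y hy2
      rw [norm_mul, norm_mul, Real.norm_of_nonneg h2, Real.norm_of_nonneg (cut n).nonneg]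
      have h4 := (cut n).le_one (x := y)
      have h5 : 0 ≤ cut n y := (cut n).nonneg
      have h6 : cut n y * reg (a k) ((4 - n) / 2) x y ≤ ker (n - 4) x y := by nlinarith
      rw [mul_comm B]
      exact mul_le_mul h6 h3 (norm_nonneg _) (ker_nonneg _ _ _)
    · rw [Set.indicator_of_notMem hy2, cut_eq_zero]
      · simp
      · have := not_le.1 (fun h => hy2 (by simpa using h)) ; exact this.le
  · filter_upwards [compl_mem_ae_iff.2 (measure_singleton x)] with y hy
    have hxy : x ≠ y := fun h => hy (by simp [h])
    exact ((tendsto_reg ha hxy).const_mul _).mul_const _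

/-- The mass of the profile to which the biharmonic regularised kernel concentrates. -/
noncomputable def profileMass (n : ℕ) : ℝ :=
  ∫ z : Eu n, (1 + ‖z‖ ^ 2) ^ ((4 - (n : ℝ)) / 2 - 4)

lemma integrable_profile : Integrable fun z : Eu n => (1 + ‖z‖ ^ 2) ^ ((4 - (n : ℝ)) / 2 - 4) := by
  have h := integrable_rpow_neg_one_add_norm_sq (E := Eu n) (μ := volume) (r := (n : ℝ) + 4)
    (by simp)
  convert h using 3
  ring

lemma profileMass_pos (hn : 5 ≤ n) : 0 < profileMass n := by
  have := nontrivial_eu hn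
  refine (integral_pos_iff_support_of_nonneg (fun z => by positivity) integrable_profile).2 ?_
  have : Function.support (fun z : Eu n => (1 + ‖z‖ ^ 2) ^ ((4 - (n : ℝ)) / 2 - 4)) = Set.univ := by
    ext z
    simp only [Function.mem_support, Set.mem_univ, iff_true]
    positivity
  rw [this]
  simp

lemma tendsto_integral_profile {e : ℕ → ℝ} (he0 : ∀ k, 0 < e k)
    (he : Tendsto e atTop (𝓝 0)) {h : Eu n → ℝ} (hm : Measurable h) {B : ℝ}
    (hB : ∀ y, |h y| ≤ B) {x : Eu n} (hx : ContinuousAt h x) :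
    Tendsto (fun k => ∫ y, h y * ((e k ^ 2) ^ 2 * reg (e k ^ 2) ((4 - n) / 2 - 4) x y)) atTop
      (𝓝 (h x * profileMass n)) := by
  have key : ∀ k, ∫ y, h y * ((e k ^ 2) ^ 2 * reg (e k ^ 2) ((4 - n) / 2 - 4) x y) =
      ∫ z : Eu n, h (x + e k • z) * (1 + ‖z‖ ^ 2) ^ ((4 - (n : ℝ)) / 2 - 4) := by
    intro k
    have hk := he0 k
    rw [← integral_add_left_eq_self _ x]
    have h1 := Measure.integral_comp_smul (volume : Measure (Eu n))
      (fun y => h (x + y) * ((e k ^ 2) ^ 2 * reg (e k ^ 2) ((4 - n) / 2 - 4) x (x + y))) (e k)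
    rw [finrank_euclideanSpace_fin, abs_of_nonneg (by positivity), smul_eq_mul,
      inv_mul_eq_div, eq_div_iff (by positivity)] at h1
    rw [← h1, ← integral_mul_const]
    refine integral_congr_ae (Eventually.of_forall fun z => ?_)
    have h2 : reg (e k ^ 2) ((4 - n) / 2 - 4) x (x + e k • z) =
        e k ^ (-(n : ℝ) - 4) * (1 + ‖z‖ ^ 2) ^ ((4 - (n : ℝ)) / 2 - 4) := by
      have h3 : e k ^ 2 + ‖x - (x + e k • z)‖ ^ 2 = e k ^ 2 * (1 + ‖z‖ ^ 2) := by
        rw [sub_add_cancel_left, norm_neg, norm_smul, Real.norm_of_nonneg hk.le]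
        ring
      rw [reg, h3, Real.mul_rpow (by positivity) (by positivity), ← Real.rpow_natCast,
        ← Real.rpow_mul hk.le]
      congr 2
      push_cast
      ring
    have h4 : (e k ^ 2) ^ 2 * e k ^ (-(n : ℝ) - 4) * e k ^ n = 1 := by
      rw [← pow_mul, ← Real.rpow_natCast, ← Real.rpow_natCast, ← Real.rpow_add hk,
        ← Real.rpow_add hk]
      convert Real.rpow_zero _ using 2
      push_cast
      ring
    simp only [h2]
    linear_combination (h (x + e k • z) * (1 + ‖z‖ ^ 2) ^ ((4 - (n : ℝ)) / 2 - 4)) * h4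
  simp_rw [key]
  rw [profileMass, ← integral_const_mul]
  refine tendsto_integral_of_dominated_convergence
    (fun z : Eu n => B * (1 + ‖z‖ ^ 2) ^ ((4 - (n : ℝ)) / 2 - 4)) ?_
    (integrable_profile.const_mul B) ?_ ?_
  · intro k
    exact ((hm.comp (by fun_prop)).mul (by fun_prop)).aestronglyMeasurable
  · intro k
    refine Eventually.of_forall fun z => ?_
    rw [norm_mul, Real.norm_of_nonneg (r := (1 + ‖z‖ ^ 2) ^ ((4 - (n : ℝ)) / 2 - 4)) (by positivity)]
    exact mul_le_mul_of_nonneg_right (hB _) (by positivity)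
  · refine Eventually.of_forall fun z => Tendsto.mul_const _ ?_
    refine hx.tendsto.comp ?_
    have := (he.smul_const z).const_add x
    simpa using this

/-- The constant in the representation formula. -/
noncomputable def reprConst (n : ℕ) : ℝ :=
  16 * ((4 - n) / 2) * ((4 - n) / 2 - 1) * ((4 - n) / 2 - 2) * ((4 - n) / 2 - 3) * profileMass n

lemma reprConst_pos (hn : 5 ≤ n) : 0 < reprConst n := by
  have hn' : (5 : ℝ) ≤ n := by exact_mod_cast hn
  have h : 0 < ((n : ℝ) - 4) / 2 := by linarith
  have := profileMass_pos hn
  have h2 : reprConst n = 16 * (((n : ℝ) - 4) / 2) * (((n : ℝ) - 4) / 2 + 1) *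
    (((n : ℝ) - 4) / 2 + 2) * (((n : ℝ) - 4) / 2 + 3) * profileMass n := by
    rw [reprConst]; ring
  rw [h2]
  positivity

/-- Splitting of the regularised Riesz potential of `Δ²u`. -/
lemma integral_reg_bilap {a : ℝ} (ha : 0 < a) {u : Eu n → ℝ} (hu : ContDiff ℝ 4 u) (x : Eu n) :
    ∫ y, cut n y * reg a ((4 - n) / 2) x y * bilap u y =
      (∫ y, (ball (0 : Eu n) 1).indicator u y * (16 * ((4 - n) / 2) * ((4 - n) / 2 - 1) *
        ((4 - n) / 2 - 2) * ((4 - n) / 2 - 3) * (a ^ 2 * reg a ((4 - n) / 2 - 4) x y))) +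
      ∫ y in closedBall 0 2 \ ball 0 1,
        u y * bilap (fun y => cut n y * reg a ((4 - n) / 2) x y) y := by
  set g : Eu n → ℝ := fun y => cut n y * reg a ((4 - n) / 2) x y with hg
  have hgs : ContDiff ℝ 4 g := (cut n).contDiff.mul (contDiff_reg ha _ x)
  have hgc : HasCompactSupport g := (cut n).hasCompactSupport.mul_right
  have hts : tsupport g ⊆ closedBall 0 2 := by
    refine (tsupport_mul_subset_left (f := cut n)).trans ?_
    rw [(cut n).tsupport_eq]
    rfl
  have h1 := integral_mul_bilap hu hgs hgc
  have hcont : Continuous (bilap g) :=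
    (contDiff_lap (k := 0) (m := 2) (contDiff_lap (k := 2) hgs (by norm_num)) (by norm_num)).continuous
  have hzero : ∀ y ∉ closedBall (0 : Eu n) 2, bilap g y = 0 := by
    intro y hy
    have : g =ᶠ[𝓝 y] fun _ => 0 := by
      have := notMem_tsupport_iff_eventuallyEq.1 (fun h => hy (hts h))
      exact this
    rw [bilap_congr this]
    have := bilap_const_mul (n := n) (fun _ => 0) 0 y
    simpa using this
  have hI : Integrable fun y => u y * bilap g y := by
    refine (hu.continuous.mul hcont).integrable_of_hasCompactSupport ?_
    refine HasCompactSupport.of_support_subset_isCompact (isCompact_closedBall (0 : Eu n) 2) ?_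
    intro y hy
    by_contra h
    exact hy (by simp [hzero y h])
  have h2 : ∫ y, g y * bilap u y = ∫ y, u y * bilap g y := by
    rw [h1]; exact integral_congr_ae (Eventually.of_forall fun y => mul_comm _ _)
  rw [h2, ← integral_add_compl (measurableSet_ball (x := (0 : Eu n)) (ε := 1)) hI]
  congr 1
  · rw [← integral_indicator measurableSet_ball]
    refine integral_congr_ae (Eventually.of_forall fun y => ?_)
    by_cases hy : y ∈ ball (0 : Eu n) 1
    · simp only [Set.indicator_of_mem hy]
      have : g =ᶠ[𝓝 y] reg a ((4 - n) / 2) x := by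
        filter_upwards [isOpen_ball.mem_nhds hy] with z hz
        rw [hg]
        simp only
        rw [cut_eq_one (by simpa using (mem_ball_zero_iff.1 hz).le), one_mul]
      rw [bilap_congr this, bilap_reg ha _ rfl]
      ring
    · simp [Set.indicator_of_notMem hy]
  · refine setIntegral_eq_of_subset_of_forall_sdiff_eq_zero measurableSet_ball.compl ?_ ?_
    · exact fun y hy => hy.2
    · intro y hy
      rw [hzero y (fun h => hy.2 ⟨h, hy.1⟩), mul_zero]

/-- Representation of `C⁴` functions by the Riesz potential of their bilaplacian, at unit scale. -/
lemma exists_repr_unit (hn : 5 ≤ n) : ∃ K : ℝ, 0 ≤ K ∧ ∀ u : Eu n → ℝ, ContDiff ℝ 4 u →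
    ∀ M : ℝ, (∀ y, |u y| ≤ M) →
    ∀ x ∈ closedBall (0 : Eu n) (1 / 2), ∀ x' ∈ closedBall (0 : Eu n) (1 / 2),
    |reprConst n * u x - ∫ y, cut n y * ker (n - 4) x y * bilap u y| ≤ K * M ∧
    |(reprConst n * u x - ∫ y, cut n y * ker (n - 4) x y * bilap u y) -
      (reprConst n * u x' - ∫ y, cut n y * ker (n - 4) x' y * bilap u y)| ≤ K * M * ‖x - x'‖ := by
  obtain ⟨K, hK0, hK⟩ := exists_commutator_bound (η := cut n) (cut n).contDiff ((4 - (n : ℝ)) / 2)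
  set A : Set (Eu n) := closedBall 0 2 \ ball 0 1 with hA
  have hAfin : volume A < ⊤ := (measure_mono Set.sdiff_subset).trans_lt measure_closedBall_lt_top
  have hAc : IsCompact A := (isCompact_closedBall _ _).diff isOpen_ball
  refine ⟨K * volume.real A, by positivity, ?_⟩
  intro u hu M hM
  have hM0 : 0 ≤ M := (abs_nonneg _).trans (hM 0)
  set e : ℕ → ℝ := fun k => 1 / ((k : ℝ) + 1) with he
  have he0 : ∀ k, 0 < e k := fun k => by rw [he]; positivity
  have he1 : ∀ k, e k ≤ 1 := fun k => by
    rw [he]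
    simp only
    rw [div_le_one (by positivity)]
    have : (0 : ℝ) ≤ k := k.cast_nonneg
    linarith
  have het : Tendsto e atTop (𝓝 0) := tendsto_one_div_add_atTop_nhds_zero_nat
  have hbl : Continuous (bilap u) :=
    (contDiff_lap (k := 0) (m := 2) (contDiff_lap (k := 2) hu (by norm_num)) (by norm_num)).continuous
  set D : ℕ → Eu n → Eu n → ℝ := fun k x y =>
    bilap (fun y => cut n y * reg (e k ^ 2) ((4 - n) / 2) x y) y with hD
  have hlim : ∀ x ∈ closedBall (0 : Eu n) (1 / 2),
      Tendsto (fun k => -∫ y in A, u y * D k x y) atTop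
        (𝓝 (reprConst n * u x - ∫ y, cut n y * ker (n - 4) x y * bilap u y)) := by
    intro x hx
    have hx1 : x ∈ ball (0 : Eu n) 1 := closedBall_subset_ball (by norm_num) hx
    have h1 := tendsto_integral_reg hn (a := fun k => e k ^ 2) (fun k => by have := he0 k; positivity)
      (by simpa using het.pow 2) hbl x
    have h2 := tendsto_integral_profile he0 het
      (h := (ball (0 : Eu n) 1).indicator u) (hu.continuous.measurable.indicator measurableSet_ball)
      (B := M) (fun y => by
        by_cases hy : y ∈ ball (0 : Eu n) 1
        · simpa [Set.indicator_of_mem hy] using hM y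
        · simpa [Set.indicator_of_notMem hy] using hM0)
      (x := x) (by
        refine hu.continuous.continuousAt.congr ?_
        filter_upwards [isOpen_ball.mem_nhds hx1] with y hy
        rw [Set.indicator_of_mem hy])
    rw [Set.indicator_of_mem hx1] at h2
    have h3 := (h2.const_mul (16 * ((4 - (n : ℝ)) / 2) * ((4 - n) / 2 - 1) *
        ((4 - n) / 2 - 2) * ((4 - n) / 2 - 3))).sub h1
    refine (h3.congr fun k => ?_).trans_eq ?_
    · rw [integral_reg_bilap (by have := he0 k; positivity) hu x, ← integral_const_mul]
      have : ∀ y, 16 * ((4 - (n : ℝ)) / 2) * ((4 - n) / 2 - 1) *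
        ((4 - n) / 2 - 2) * ((4 - n) / 2 - 3) * ((ball (0 : Eu n) 1).indicator u y *
          ((e k ^ 2) ^ 2 * reg (e k ^ 2) ((4 - n) / 2 - 4) x y)) =
          (ball (0 : Eu n) 1).indicator u y * (16 * ((4 - n) / 2) * ((4 - n) / 2 - 1) *
        ((4 - n) / 2 - 2) * ((4 - n) / 2 - 3) *
          ((e k ^ 2) ^ 2 * reg (e k ^ 2) ((4 - n) / 2 - 4) x y)) := fun y => by ring
      simp_rw [this]
      ring
    · rw [reprConst]
      congr 1
      ring
  have hDc : ∀ k x, Continuous (D k x) := fun k x => by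
    have hk := he0 k
    have : ContDiff ℝ 4 (fun y => cut n y * reg (e k ^ 2) ((4 - n) / 2) x y) :=
      (cut n).contDiff.mul (contDiff_reg (by positivity) _ x)
    exact (contDiff_lap (k := 0) (m := 2) (contDiff_lap (k := 2) this (by norm_num))
      (by norm_num)).continuous
  have hker : ∀ k x, IntegrableOn (fun y => u y * D k x y) A := fun k x =>
    (hu.continuous.mul (hDc k x)).continuousOn.integrableOn_compact hAc
  have hKD : ∀ k, ∀ y ∈ A, ∀ x ∈ closedBall (0 : Eu n) (1 / 2),
      ∀ x' ∈ closedBall (0 : Eu n) (1 / 2), |D k x y| ≤ K ∧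
      |D k x y - D k x' y| ≤ K * ‖x - x'‖ := by
    intro k y hy x hx x' hx'
    have hk := he0 k
    exact hK (e k ^ 2) ⟨by positivity, pow_le_one₀ hk.le (he1 k)⟩ y (by simpa using hy.2)
      (by simpa using hy.1) x hx x' hx'
  intro x hx x' hx'
  constructor
  · refine le_of_tendsto (hlim x hx).abs (Eventually.of_forall fun k => ?_)
    rw [abs_neg]
    have := norm_setIntegral_le_of_norm_le_const (f := fun y => u y * D k x y) (C := M * K) hAfin
      (fun y hy => by
        rw [norm_mul]
        exact mul_le_mul (hM y) (hKD k y hy x hx x' hx').1 (norm_nonneg _) hM0)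
    refine this.trans_eq ?_
    ring
  · refine le_of_tendsto ((hlim x hx).sub (hlim x' hx')).abs (Eventually.of_forall fun k => ?_)
    rw [neg_sub_neg, ← integral_sub (hker k x') (hker k x)]
    have := norm_setIntegral_le_of_norm_le_const
      (f := fun y => u y * D k x' y - u y * D k x y) (C := M * (K * ‖x - x'‖)) hAfin
      (fun y hy => by
        rw [← mul_sub, norm_mul]
        refine mul_le_mul (hM y) ?_ (norm_nonneg _) hM0
        rw [norm_sub_rev]
        exact (hKD k y hy x hx x' hx').2)
    refine this.trans_eq ?_
    ring

/-- Representation of `C⁴` functions by the Riesz potential of their bilaplacian, at scale `R`. -/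
lemma exists_repr (hn : 5 ≤ n) : ∃ K : ℝ, 0 ≤ K ∧ ∀ R : ℝ, 0 < R → ∀ v : Eu n → ℝ,
    ContDiffOn ℝ 4 v (ball 0 (3 * R)) → ∀ M : ℝ, (∀ y ∈ ball 0 (3 * R), |v y| ≤ M) →
    ∀ x ∈ closedBall (0 : Eu n) (R / 2), ∀ x' ∈ closedBall (0 : Eu n) (R / 2),
    |reprConst n * v x - ∫ y, cut n (R⁻¹ • y) * ker (n - 4) x y * bilap v y| ≤ K * M ∧
    |(reprConst n * v x - ∫ y, cut n (R⁻¹ • y) * ker (n - 4) x y * bilap v y) -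
      (reprConst n * v x' - ∫ y, cut n (R⁻¹ • y) * ker (n - 4) x' y * bilap v y)|
      ≤ K * M * ‖x - x'‖ / R := by
  obtain ⟨K, hK0, hK⟩ := exists_repr_unit hn
  refine ⟨K, hK0, ?_⟩
  intro R hR v hv M hM
  have hM0 : 0 ≤ M := (abs_nonneg _).trans (hM 0 (by simpa using hR))
  let ζ : ContDiffBump (0 : Eu n) := ⟨5 / 2, 11 / 4, by norm_num, by norm_num⟩
  have hsm : ∀ y ∈ ball (0 : Eu n) 3, R • y ∈ ball (0 : Eu n) (3 * R) := by
    intro y hy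
    rw [mem_ball_zero_iff] at hy ⊢
    rw [norm_smul, Real.norm_of_nonneg hR.le]
    nlinarith
  set u : Eu n → ℝ := fun y => ζ y * v (0 + R • y) with hu
  have hts : tsupport u ⊆ closedBall 0 (11 / 4) := by
    refine (tsupport_mul_subset_left (f := ζ)).trans ?_
    rw [ζ.tsupport_eq]
  have hus : ContDiff ℝ 4 u := by
    refine contDiff_iff_contDiffAt.2 fun y => ?_
    by_cases hy : y ∉ tsupport u
    · exact contDiffAt_const.congr_of_eventuallyEq (notMem_tsupport_iff_eventuallyEq.1 hy)
    rw [not_not] at hy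
    have hy3 : y ∈ ball (0 : Eu n) 3 := closedBall_subset_ball (by norm_num) (hts hy)
    have h1 : ContDiffAt ℝ 4 v (0 + R • y) := by
      rw [zero_add]
      exact hv.contDiffAt (isOpen_ball.mem_nhds (hsm y hy3))
    exact ζ.contDiff.contDiffAt.mul (h1.comp y (by fun_prop))
  have huM : ∀ y, |u y| ≤ M := by
    intro y
    by_cases hy : y ∈ ball (0 : Eu n) 3
    · have h1 := hM _ (hsm y hy)
      simp only [hu, zero_add, abs_mul, abs_of_nonneg ζ.nonneg]
      have h2 : ζ y ≤ 1 := ζ.le_one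
      have h3 : 0 ≤ ζ y := ζ.nonneg
      nlinarith [abs_nonneg (v (R • y))]
    · have : u y = 0 := by
        have h3 : ζ y = 0 := ζ.zero_of_le_dist (by
          have : (3 : ℝ) ≤ ‖y‖ := by simpa using hy
          simp only [dist_zero_right, ζ]
          linarith)
        simp [hu, h3]
      simpa [this] using hM0
  have hloc : ∀ y, ‖y‖ < 5 / 2 → u =ᶠ[𝓝 y] fun y => v (0 + R • y) := by
    intro y hy
    filter_upwards [isOpen_ball.mem_nhds (mem_ball_zero_iff.2 hy)] with z hz
    have : ζ z = 1 := ζ.one_of_mem_closedBall (ball_subset_closedBall hz)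
    simp [hu, this]
  have hval : ∀ x ∈ closedBall (0 : Eu n) (R / 2), u (R⁻¹ • x) = v x := by
    intro x hx
    have hx' : ‖x‖ ≤ R / 2 := by simpa using hx
    have hxR : ‖R⁻¹ • x‖ < 5 / 2 := by
      rw [norm_smul, norm_inv, Real.norm_of_nonneg hR.le, inv_mul_eq_div, div_lt_iff₀ hR]
      linarith
    rw [(hloc _ hxR).self_of_nhds]
    simp only [zero_add, smul_inv_smul₀ hR.ne']
  have hker : ∀ x, ∫ y, cut n y * ker (n - 4) (R⁻¹ • x) y * bilap u y =
      ∫ y, cut n (R⁻¹ • y) * ker (n - 4) x y * bilap v y := by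
    intro x
    have h1 := Measure.integral_comp_smul (volume : Measure (Eu n))
      (fun y => cut n (R⁻¹ • y) * ker (n - 4) x y * bilap v y) R
    rw [finrank_euclideanSpace_fin, abs_of_nonneg (by positivity), smul_eq_mul,
      inv_mul_eq_div, eq_div_iff (by positivity)] at h1
    rw [← h1, ← integral_mul_const]
    refine integral_congr_ae (Eventually.of_forall fun y => ?_)
    simp only [inv_smul_smul₀ hR.ne']
    by_cases hy : ‖y‖ < 5 / 2
    · rw [bilap_congr (hloc y hy), bilap_comp_affine, zero_add]
      have h2 : ker ((n : ℝ) - 4) x (R • y) = R ^ (-((n : ℝ) - 4)) * ker (n - 4) (R⁻¹ • x) y := by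
        have : x - R • y = R • (R⁻¹ • x - y) := by rw [smul_sub, smul_inv_smul₀ hR.ne']
        rw [ker, ker, this, norm_smul, Real.norm_of_nonneg hR.le,
          Real.mul_rpow hR.le (norm_nonneg _)]
      have h3 : R ^ (-((n : ℝ) - 4)) * R ^ n = R ^ 4 := by
        rw [← Real.rpow_natCast, ← Real.rpow_natCast, ← Real.rpow_add hR]
        congr 1
        push_cast
        ring
      rw [h2]
      linear_combination (-cut n y * ker (n - 4) (R⁻¹ • x) y * bilap v (R • y)) * h3
    · rw [cut_eq_zero (by linarith)]
      simp
  have hmem : ∀ x ∈ closedBall (0 : Eu n) (R / 2), R⁻¹ • x ∈ closedBall (0 : Eu n) (1 / 2) := by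
    intro x hx
    have hx' : ‖x‖ ≤ R / 2 := by simpa using hx
    rw [mem_closedBall_zero_iff, norm_smul, norm_inv, Real.norm_of_nonneg hR.le, inv_mul_eq_div,
      div_le_iff₀ hR]
    linarith
  intro x hx x' hx'
  have h := hK u hus M huM _ (hmem x hx) _ (hmem x' hx')
  rw [hval x hx, hval x' hx', hker, hker, ← smul_sub, norm_smul, norm_inv,
    Real.norm_of_nonneg hR.le] at h
  refine ⟨h.1, h.2.trans_eq ?_⟩
  field_simp

end Representation

section Limit

variable {n : ℕ}

lemma abs_rpow_neg_sub_le {a b m : ℝ} (ha : 0 < a) (hb : 0 < b) (hm : 0 ≤ m) :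
    |a ^ (-m) - b ^ (-m)| ≤ m * |a - b| * (a ^ (-(m + 1)) + b ^ (-(m + 1))) := by
  wlog hab : a ≤ b generalizing a b
  · have := this hb ha (not_le.1 hab).le
    rwa [abs_sub_comm, abs_sub_comm a, add_comm (a ^ (-(m + 1)))]
  have h1 : b ^ (-m) ≤ a ^ (-m) := Real.rpow_le_rpow_of_nonpos ha hab (by linarith)
  rw [abs_of_nonneg (by linarith), abs_sub_comm, abs_of_nonneg (by linarith)]
  have h2 : b ^ (-m) = a ^ (-m) * Real.exp (-m * Real.log (b / a)) := by
    rw [mul_comm (-m), ← Real.rpow_def_of_pos (by positivity), ← Real.mul_rpow ha.le (by positivity),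
      mul_div_cancel₀ _ ha.ne']
  have h3 := Real.add_one_le_exp (-m * Real.log (b / a))
  have h4 := Real.log_le_sub_one_of_pos (show 0 < b / a by positivity)
  have h5 : 1 - m * (b / a - 1) ≤ Real.exp (-m * Real.log (b / a)) := by nlinarith
  have h6 : a ^ (-(m + 1)) = a ^ (-m) / a := by
    rw [neg_add, Real.rpow_add ha, Real.rpow_neg_one, div_eq_mul_inv]
  have h7 : a ^ (-m) - b ^ (-m) ≤ a ^ (-m) * (m * (b / a - 1)) := by
    rw [h2]
    have : 0 < a ^ (-m) := by positivity
    nlinarith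
  have h8 : a ^ (-m) * (m * (b / a - 1)) = m * (b - a) * a ^ (-(m + 1)) := by
    rw [h6]; field_simp
  have h9 : 0 ≤ m * (b - a) * b ^ (-(m + 1)) := by
    have : 0 ≤ b - a := by linarith
    positivity
  nlinarith

lemma abs_ker_sub_le {m : ℝ} (hm : 0 ≤ m) {x x' y : Eu n} (hx : x ≠ y) (hx' : x' ≠ y) :
    |ker m x y - ker m x' y| ≤ m * ‖x - x'‖ * (ker (m + 1) x y + ker (m + 1) x' y) := by
  have h0 : 0 < ‖x - y‖ := by simpa [sub_eq_zero] using hx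
  have h0' : 0 < ‖x' - y‖ := by simpa [sub_eq_zero] using hx'
  refine (abs_rpow_neg_sub_le h0 h0' hm).trans ?_
  have h1 : |‖x - y‖ - ‖x' - y‖| ≤ ‖x - x'‖ := by
    simpa using abs_norm_sub_norm_le (x - y) (x' - y)
  have := ker_nonneg (m + 1) x y
  have := ker_nonneg (m + 1) x' y
  unfold ker at *
  gcongr

lemma ae_ne (hn : 5 ≤ n) (x : Eu n) : ∀ᵐ y ∂(volume : Measure (Eu n)), x ≠ y := by
  have := nontrivial_eu hn
  filter_upwards [compl_mem_ae_iff.2 (measure_singleton x)] with y hy h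
  exact hy (by simp [h])

/-- The gradient kernel is controlled by the kernel away from the singularity. -/
lemma integral_ker_succ_le (hn : 5 ≤ n) {g : Eu n → ℝ} (hgm : Measurable g) {G : ℝ}
    (hg : ∀ y, 0 ≤ g y ∧ g y ≤ G) (x : Eu n)
    (hi : Integrable fun y => ker ((n : ℝ) - 4) x y * g y) :
    (Integrable fun y => ker ((n : ℝ) - 4 + 1) x y * g y) ∧
    ∫ y, ker ((n : ℝ) - 4 + 1) x y * g y ≤
      G * inMass n (n - 4 + 1) + ∫ y, ker ((n : ℝ) - 4) x y * g y := by
  have hn' : (5 : ℝ) ≤ n := by exact_mod_cast hn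
  have h1 : IntegrableOn (fun y => G * ker ((n : ℝ) - 4 + 1) x y) (ball x 1) :=
    (integrableOn_ker_ball hn (by linarith) x 1).const_mul G
  have h1' := h1.integrable_indicator measurableSet_ball
  have hle : ∀ᵐ y, ker ((n : ℝ) - 4 + 1) x y * g y ≤
      (ball x 1).indicator (fun y => G * ker ((n : ℝ) - 4 + 1) x y) y +
        ker ((n : ℝ) - 4) x y * g y := by
    filter_upwards [ae_ne hn x] with y hy
    have h2 := ker_nonneg ((n : ℝ) - 4 + 1) x y
    have h3 := ker_nonneg ((n : ℝ) - 4) x y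
    have h4 := hg y
    by_cases hyb : y ∈ ball x 1
    · rw [Set.indicator_of_mem hyb]
      nlinarith [mul_nonneg h3 h4.1, mul_le_mul_of_nonneg_left h4.2 h2]
    · rw [Set.indicator_of_notMem hyb, zero_add]
      refine mul_le_mul_of_nonneg_right ?_ h4.1
      have : 1 ≤ ‖x - y‖ := by
        rw [norm_sub_rev]
        simpa [dist_eq_norm] using hyb
      exact Real.rpow_le_rpow_of_exponent_le this (by linarith)
  have hker : Integrable fun y => ker ((n : ℝ) - 4 + 1) x y * g y := by
    refine (h1'.add hi).mono' ((measurable_ker _ x).mul hgm).aestronglyMeasurable ?_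
    filter_upwards [hle] with y hy
    rw [Real.norm_of_nonneg (mul_nonneg (ker_nonneg _ _ _) (hg y).1)]
    exact hy
  refine ⟨hker, (integral_mono_ae hker (h1'.add hi) hle).trans_eq ?_⟩
  rw [integral_add' h1' hi, integral_indicator measurableSet_ball, integral_const_mul,
    setIntegral_ker_ball x one_pos, Real.one_rpow, one_mul]

lemma abs_integral_ker_sub_le (hn : 5 ≤ n) {g : Eu n → ℝ} (hgm : Measurable g) {G : ℝ}
    (hg : ∀ y, 0 ≤ g y ∧ g y ≤ G) {x x' : Eu n}
    (hi : Integrable fun y => ker ((n : ℝ) - 4) x y * g y)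
    (hi' : Integrable fun y => ker ((n : ℝ) - 4) x' y * g y) (S : Set (Eu n)) :
    |∫ y in S, ker ((n : ℝ) - 4) x y * g y - ker ((n : ℝ) - 4) x' y * g y| ≤
      ((n : ℝ) - 4) * ‖x - x'‖ * (∫ y in S, ker ((n : ℝ) - 4 + 1) x y * g y +
        ker ((n : ℝ) - 4 + 1) x' y * g y) := by
  have hn' : (5 : ℝ) ≤ n := by exact_mod_cast hn
  have h1 := (integral_ker_succ_le hn hgm hg x hi).1
  have h2 := (integral_ker_succ_le hn hgm hg x' hi').1
  rw [← integral_const_mul, ← Real.norm_eq_abs]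
  refine norm_integral_le_of_norm_le ((h1.add h2).integrableOn.const_mul _) ?_
  filter_upwards [ae_restrict_of_ae (ae_ne hn x), ae_restrict_of_ae (ae_ne hn x')] with y hy hy'
  have h3 := abs_ker_sub_le (m := (n : ℝ) - 4) (by linarith) hy hy'
  rw [← sub_mul, norm_mul, Real.norm_of_nonneg (hg y).1, Real.norm_eq_abs]
  refine (mul_le_mul_of_nonneg_right h3 (hg y).1).trans_eq ?_
  ring

lemma potential_lipschitz (hn : 5 ≤ n) {g : Eu n → ℝ} (hgm : Measurable g) {G C : ℝ}
    (hg : ∀ y, 0 ≤ g y ∧ g y ≤ G) {x x' : Eu n}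
    (hi : Integrable fun y => ker ((n : ℝ) - 4) x y * g y)
    (hi' : Integrable fun y => ker ((n : ℝ) - 4) x' y * g y)
    (hC : ∫ y, ker ((n : ℝ) - 4) x y * g y ≤ C) (hC' : ∫ y, ker ((n : ℝ) - 4) x' y * g y ≤ C) :
    |(∫ y, ker ((n : ℝ) - 4) x y * g y) - ∫ y, ker ((n : ℝ) - 4) x' y * g y| ≤
      ((n : ℝ) - 4) * (2 * (G * inMass n (n - 4 + 1) + C)) * ‖x - x'‖ := by
  have hn' : (5 : ℝ) ≤ n := by exact_mod_cast hn
  have h := abs_integral_ker_sub_le hn hgm hg hi hi' Set.univ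
  have h1 := integral_ker_succ_le hn hgm hg x hi
  have h2 := integral_ker_succ_le hn hgm hg x' hi'
  rw [setIntegral_univ, setIntegral_univ, integral_sub hi hi', integral_add h1.1 h2.1] at h
  refine h.trans ?_
  have : 0 ≤ ((n : ℝ) - 4) * ‖x - x'‖ := mul_nonneg (by linarith) (norm_nonneg _)
  nlinarith [h1.2, h2.2]

lemma far_potential_lipschitz (hn : 5 ≤ n) {g : Eu n → ℝ} (hgm : Measurable g) {G C r : ℝ}
    (hr : 0 < r) (hg : ∀ y, 0 ≤ g y ∧ g y ≤ G) {x x' : Eu n} (hx : ‖x‖ ≤ r / 2) (hx' : ‖x'‖ ≤ r / 2)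
    (hi : Integrable fun y => ker ((n : ℝ) - 4) x y * g y)
    (hi' : Integrable fun y => ker ((n : ℝ) - 4) x' y * g y)
    (hC : ∫ y, ker ((n : ℝ) - 4) x y * g y ≤ C) (hC' : ∫ y, ker ((n : ℝ) - 4) x' y * g y ≤ C) :
    |(∫ y in (ball 0 r)ᶜ, ker ((n : ℝ) - 4) x y * g y) -
      ∫ y in (ball 0 r)ᶜ, ker ((n : ℝ) - 4) x' y * g y| ≤
      ((n : ℝ) - 4) * (4 * C) * ‖x - x'‖ / r := by
  have hn' : (5 : ℝ) ≤ n := by exact_mod_cast hn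
  have h := abs_integral_ker_sub_le hn hgm hg hi hi' (ball 0 r)ᶜ
  have key : ∀ z : Eu n, ‖z‖ ≤ r / 2 → Integrable (fun y => ker ((n : ℝ) - 4) z y * g y) →
      ∫ y, ker ((n : ℝ) - 4) z y * g y ≤ C →
      ∫ y in (ball 0 r)ᶜ, ker ((n : ℝ) - 4 + 1) z y * g y ≤ 2 / r * C := by
    intro z hz hzi hzC
    have h1 := integral_ker_succ_le hn hgm hg z hzi
    have h2 : ∫ y in (ball 0 r)ᶜ, ker ((n : ℝ) - 4 + 1) z y * g y ≤
        ∫ y in (ball 0 r)ᶜ, 2 / r * (ker ((n : ℝ) - 4) z y * g y) := by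
      refine setIntegral_mono_on h1.1.integrableOn (hzi.const_mul _).integrableOn
        measurableSet_ball.compl fun y hy => ?_
      have hy' : r ≤ ‖y‖ := by simpa using hy
      have h3 : r / 2 ≤ ‖z - y‖ := by
        have := norm_sub_norm_le y z
        rw [norm_sub_rev] at this
        linarith
      have h4 : 0 < ‖z - y‖ := by linarith
      have h5 : ker ((n : ℝ) - 4 + 1) z y = ‖z - y‖⁻¹ * ker ((n : ℝ) - 4) z y := by
        rw [ker, ker, neg_add, Real.rpow_add h4, Real.rpow_neg_one, mul_comm]
      rw [h5, mul_assoc]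
      refine mul_le_mul_of_nonneg_right ?_ (mul_nonneg (ker_nonneg _ _ _) (hg y).1)
      rw [inv_le_comm₀ h4 (by positivity)]
      simpa using h3
    rw [integral_const_mul] at h2
    have h6 : ∫ y in (ball 0 r)ᶜ, ker ((n : ℝ) - 4) z y * g y ≤ ∫ y, ker ((n : ℝ) - 4) z y * g y :=
      setIntegral_le_integral hzi (Eventually.of_forall fun y =>
        mul_nonneg (ker_nonneg _ _ _) (hg y).1)
    have h7 : 0 ≤ 2 / r := by positivity
    nlinarith
  have h1 := integral_ker_succ_le hn hgm hg x hi
  have h2 := integral_ker_succ_le hn hgm hg x' hi'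
  rw [integral_sub hi.integrableOn hi'.integrableOn,
    integral_add h1.1.integrableOn h2.1.integrableOn] at h
  refine h.trans ?_
  have h3 : 0 ≤ ((n : ℝ) - 4) * ‖x - x'‖ := mul_nonneg (by linarith) (norm_nonneg _)
  have h4 := mul_le_mul_of_nonneg_left (add_le_add (key x hx hi hC) (key x' hx' hi' hC')) h3
  refine h4.trans_eq ?_
  ring

lemma abs_rpow_sub_rpow_le {p M s t : ℝ} (hp : 1 < p) (hs : s ∈ Set.Icc 0 M)
    (ht : t ∈ Set.Icc 0 M) : |s ^ p - t ^ p| ≤ p * M ^ (p - 1) * |s - t| := by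
  have h := (convex_Icc (0 : ℝ) M).norm_image_sub_le_of_norm_hasDerivWithin_le
    (f := fun z : ℝ => z ^ p) (f' := fun z => p * z ^ (p - 1)) (C := p * M ^ (p - 1))
    (fun z _ => (Real.hasDerivAt_rpow_const (Or.inr hp.le)).hasDerivWithinAt)
    (fun z hz => by
      have h1 : z ^ (p - 1) ≤ M ^ (p - 1) := Real.rpow_le_rpow hz.1 hz.2 (by linarith)
      have h2 : 0 ≤ z ^ (p - 1) := Real.rpow_nonneg hz.1 _
      rw [Real.norm_of_nonneg (by positivity)]
      exact mul_le_mul_of_nonneg_left h1 (by linarith)) ht hs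
  simpa using h

/-- Passage to the limit in a sequence of approximate integral equations on growing balls. -/
lemma exists_limit (hn : 5 ≤ n) {p M K G : ℝ} (hp : 1 < p) (hM0 : 0 ≤ M) (hK0 : 0 ≤ K)
    {v g : ℕ → Eu n → ℝ}
    (hv : ∀ k : ℕ, ∀ x ∈ closedBall (0 : Eu n) (k + 1), v k x ∈ Set.Icc 0 M)
    (hgm : ∀ k, Measurable (g k)) (hg : ∀ k y, 0 ≤ g k y ∧ g k y ≤ G)
    (hgv : ∀ k : ℕ, ∀ x ∈ closedBall (0 : Eu n) (k + 1), g k x = v k x ^ p)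
    (hgi : ∀ k x, Integrable fun y => ker ((n : ℝ) - 4) x y * g k y)
    (hE : ∀ k : ℕ, ∀ x ∈ closedBall (0 : Eu n) ((k + 1) / 2),
      ∀ x' ∈ closedBall (0 : Eu n) ((k + 1) / 2),
      |reprConst n * v k x - ∫ y, ker ((n : ℝ) - 4) x y * g k y| ≤ K ∧
      |(reprConst n * v k x - ∫ y, ker ((n : ℝ) - 4) x y * g k y) -
        (reprConst n * v k x' - ∫ y, ker ((n : ℝ) - 4) x' y * g k y)| ≤ K * ‖x - x'‖ / (k + 1)) :
    ∃ w : Eu n → ℝ, Continuous w ∧ (∀ x, w x ∈ Set.Icc 0 M) ∧ ((∀ k, v k 0 = 1) → w 0 = 1) ∧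
      ∃ c₀ : ℝ, ∀ x, (Integrable fun y => ker ((n : ℝ) - 4) x y * w y ^ p) ∧
        reprConst n * w x = (∫ y, ker ((n : ℝ) - 4) x y * w y ^ p) + c₀ := by
  have hn' : (5 : ℝ) ≤ n := by exact_mod_cast hn
  have hc := reprConst_pos hn
  set c := reprConst n with hcdef
  set C1 := c * M + K with hC1
  set J : ℕ → Eu n → ℝ := fun k x => ∫ y, ker ((n : ℝ) - 4) x y * g k y with hJ
  have hsub : ∀ (k : ℕ) x, x ∈ closedBall (0 : Eu n) ((k + 1) / 2) →
      x ∈ closedBall (0 : Eu n) (k + 1) := fun k x hx =>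
    closedBall_subset_closedBall (by have : (0 : ℝ) ≤ k := k.cast_nonneg; linarith) hx
  have hJC : ∀ k : ℕ, ∀ x ∈ closedBall (0 : Eu n) ((k + 1) / 2), J k x ≤ C1 := by
    intro k x hx
    have h1 := abs_le.1 (hE k x hx x hx).1
    have h2 := mul_le_mul_of_nonneg_left (hv k x (hsub k x hx)).2 hc.le
    simp only [hJ, hC1]
    linarith
  set Λ := (((n : ℝ) - 4) * (2 * (G * inMass n (n - 4 + 1) + C1)) + K) / c with hΛ
  have hLip : ∀ k : ℕ, ∀ x ∈ closedBall (0 : Eu n) ((k + 1) / 2),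
      ∀ x' ∈ closedBall (0 : Eu n) ((k + 1) / 2), |v k x - v k x'| ≤ Λ * ‖x - x'‖ := by
    intro k x hx x' hx'
    have h1 := potential_lipschitz hn (hgm k) (hg k) (hgi k x) (hgi k x') (hJC k x hx)
      (hJC k x' hx')
    have h2 := (hE k x hx x' hx').2
    have h3 : K * ‖x - x'‖ / (k + 1) ≤ K * ‖x - x'‖ :=
      div_le_self (by positivity) (by have : (0 : ℝ) ≤ k := k.cast_nonneg; linarith)
    have h4 : |c * (v k x - v k x')| ≤ (((n : ℝ) - 4) * (2 * (G * inMass n (n - 4 + 1) + C1)) + K)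
        * ‖x - x'‖ := by
      have h5 : c * (v k x - v k x') = ((c * v k x - J k x) - (c * v k x' - J k x')) +
        (J k x - J k x') := by ring
      rw [h5, add_mul]
      refine (abs_add_le _ _).trans ?_
      simp only [hJ]
      linarith
    rw [abs_mul, abs_of_pos hc] at h4
    rw [hΛ, div_mul_eq_mul_div, le_div_iff₀ hc, mul_comm]
    exact h4
  set F : Filter ℕ := (hyperfilter ℕ : Filter ℕ) with hF
  have hFle : F ≤ atTop := Nat.hyperfilter_le_atTop
  have hev : ∀ r : ℝ, ∀ᶠ k : ℕ in F, r ≤ ((k : ℝ) + 1) / 2 := fun r => by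
    have h1 : Tendsto (fun k : ℕ => ((k : ℝ) + 1) / 2) atTop atTop :=
      (tendsto_natCast_atTop_atTop.atTop_add tendsto_const_nhds).atTop_div_const two_pos
    exact (h1.eventually_ge_atTop r).filter_mono hFle
  have hevx : ∀ x : Eu n, ∀ᶠ k : ℕ in F, x ∈ closedBall (0 : Eu n) (((k : ℝ) + 1) / 2) := fun x => by
    filter_upwards [hev ‖x‖] with k hk
    simpa using hk
  have hlim : ∀ x, ∃ a ∈ Set.Icc 0 M, Tendsto (fun k => v k x) F (𝓝 a) := by
    intro x
    have h1 : ∀ᶠ k in F, v k x ∈ Set.Icc 0 M := by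
      filter_upwards [hevx x] with k hk using hv k x (hsub k x hk)
    have := (isCompact_Icc (a := (0 : ℝ)) (b := M)).ultrafilter_le_nhds
      ((hyperfilter ℕ).map fun k => v k x) (by
        rw [le_principal_iff]
        exact h1)
    simpa [Tendsto] using this
  choose w hwM hw using hlim
  have hwL : ∀ x x', |w x - w x'| ≤ Λ * ‖x - x'‖ := by
    intro x x'
    refine le_of_tendsto ((hw x).sub (hw x')).abs ?_
    filter_upwards [hevx x, hevx x'] with k hk hk' using hLip k x hk x' hk'
  have hwc : Continuous w := by
    refine (LipschitzWith.of_dist_le_mul (K := Λ.toNNReal) fun x x' => ?_).continuous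
    rw [dist_eq_norm, dist_eq_norm, Real.norm_eq_abs]
    exact (hwL x x').trans (mul_le_mul_of_nonneg_right (Real.le_coe_toNNReal Λ) (norm_nonneg _))
  have hΛ0 : 0 ≤ |Λ| := abs_nonneg _
  have hunif : ∀ r : ℝ, ∀ ε > 0, ∀ᶠ k in F, ∀ y ∈ closedBall (0 : Eu n) r, |v k y - w y| ≤ ε := by
    intro r ε hε
    set δ := ε / (2 * |Λ| + 1) with hδ
    have hδ0 : 0 < δ := by positivity
    obtain ⟨t, hts, htf, htc⟩ := (isCompact_closedBall (0 : Eu n) r).finite_cover_balls hδ0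
    have h1 : ∀ᶠ k in F, ∀ z ∈ t, |v k z - w z| < δ := by
      rw [htf.eventually_all]
      intro z _
      have := (hw z).sub_const (w z)
      rw [sub_self] at this
      simpa using this.abs.eventually_lt_const (by simpa using hδ0)
    filter_upwards [h1, hev r] with k hk hkr y hy
    obtain ⟨z, hz, hyz⟩ := Set.mem_iUnion₂.1 (htc hy)
    have hyk := closedBall_subset_closedBall hkr hy
    have hzk := closedBall_subset_closedBall hkr (hts hz)
    have h2 := hLip k y hyk z hzk
    have h3 := hwL z y
    have h4 : ‖y - z‖ ≤ δ := by rw [← dist_eq_norm]; exact (mem_ball.1 hyz).le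
    rw [norm_sub_rev] at h3
    have h5 : Λ * ‖y - z‖ ≤ |Λ| * δ :=
      mul_le_mul (le_abs_self _) h4 (norm_nonneg _) hΛ0
    have h6 := abs_sub_le (v k y) (v k z) (w y)
    have h7 := abs_sub_le (v k z) (w z) (w y)
    have h8 := hk z hz
    have h9 : (2 * |Λ| + 1) * δ = ε := by rw [hδ]; field_simp
    linarith
  have hwpm : Measurable fun y => w y ^ p := hwc.measurable.pow_const p
  have hwp0 : ∀ y, 0 ≤ w y ^ p := fun y => Real.rpow_nonneg (hwM y).1 _
  have hwpG : ∀ y, |w y ^ p| ≤ M ^ p := fun y => by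
    rw [abs_of_nonneg (hwp0 y)]
    exact Real.rpow_le_rpow (hwM y).1 (hwM y).2 (by linarith)
  have hwi : ∀ x r, IntegrableOn (fun y => ker ((n : ℝ) - 4) x y * w y ^ p) (ball 0 r) := by
    intro x r
    have h1 := integrableOn_ker hn (s := (n : ℝ) - 4) (by linarith) (by linarith) x
      (S := ball 0 r) measure_ball_lt_top.ne
    exact h1.mul_bdd (c := M ^ p) hwpm.aestronglyMeasurable (Eventually.of_forall hwpG)
  have hconv : ∀ x r, Tendsto (fun k => ∫ y in ball 0 r, ker ((n : ℝ) - 4) x y * g k y) F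
      (𝓝 (∫ y in ball 0 r, ker ((n : ℝ) - 4) x y * w y ^ p)) := by
    intro x r
    have hker := integrableOn_ker hn (s := (n : ℝ) - 4) (by linarith) (by linarith) x
      (S := ball (0 : Eu n) r) measure_ball_lt_top.ne
    set I := ∫ y in ball (0 : Eu n) r, ker ((n : ℝ) - 4) x y with hI
    have hI0 : 0 ≤ I := integral_nonneg fun y => ker_nonneg _ _ _
    rw [Metric.tendsto_nhds]
    intro ε hε
    set L := p * M ^ (p - 1) with hL
    have hL0 : 0 ≤ L := by positivity
    set δ := ε / (2 * (L * I + 1)) with hδ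
    have hδ0 : 0 < δ := by positivity
    filter_upwards [hunif r δ hδ0, hev r] with k hk hkr
    rw [dist_eq_norm, ← integral_sub (hgi k x).integrableOn (hwi x r)]
    have h1 : ‖∫ y in ball 0 r, ker ((n : ℝ) - 4) x y * g k y - ker ((n : ℝ) - 4) x y * w y ^ p‖ ≤
        ∫ y in ball 0 r, (L * δ) * ker ((n : ℝ) - 4) x y := by
      refine norm_integral_le_of_norm_le (hker.const_mul _) ?_
      rw [ae_restrict_iff' measurableSet_ball]
      refine Eventually.of_forall fun y hy => ?_
      have hyr := ball_subset_closedBall hy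
      have hyk := hsub k y (closedBall_subset_closedBall hkr hyr)
      rw [← mul_sub, norm_mul, Real.norm_of_nonneg (ker_nonneg _ _ _), mul_comm, hgv k y hyk]
      refine mul_le_mul_of_nonneg_right ?_ (ker_nonneg _ _ _)
      exact (abs_rpow_sub_rpow_le hp (hv k y hyk) (hwM y)).trans
        (mul_le_mul_of_nonneg_left (hk y hyr) hL0)
    rw [integral_const_mul] at h1
    have h2 : L * δ * I < ε := by
      have h3 : δ * (2 * (L * I + 1)) = ε := by rw [hδ]; field_simp
      nlinarith [mul_nonneg hL0 hI0]
    exact h1.trans_lt h2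
  have hball : ∀ x r, ∫ y in ball 0 r, ker ((n : ℝ) - 4) x y * w y ^ p ≤ C1 := by
    intro x r
    refine le_of_tendsto (hconv x r) ?_
    filter_upwards [hevx x] with k hk
    refine (setIntegral_le_integral (hgi k x) (Eventually.of_forall fun y =>
        mul_nonneg (ker_nonneg _ _ _) (hg k y).1)).trans (hJC k x hk)
  have hcov : AECover (volume : Measure (Eu n)) atTop fun r : ℝ => ball (0 : Eu n) r :=
    aecover_ball tendsto_id
  have hwint : ∀ x, Integrable fun y => ker ((n : ℝ) - 4) x y * w y ^ p := fun x =>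
    hcov.integrable_of_integral_bounded_of_nonneg_ae C1 (hwi x)
      (Eventually.of_forall fun y => mul_nonneg (ker_nonneg _ _ _) (hwp0 y))
      (Eventually.of_forall (hball x))
  refine ⟨w, hwc, hwM, fun h => ?_, c * w 0 - ∫ y, ker ((n : ℝ) - 4) 0 y * w y ^ p, fun x =>
    ⟨hwint x, ?_⟩⟩
  · refine tendsto_nhds_unique (hw 0) ?_
    simp_rw [h]
    exact tendsto_const_nhds
  set T : ℝ → Eu n → ℝ := fun r x => c * w x - ∫ y in ball 0 r, ker ((n : ℝ) - 4) x y * w y ^ p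
    with hT
  have hosc : ∀ᶠ r : ℝ in atTop, |T r x - T r 0| ≤ ((n : ℝ) - 4) * (4 * C1) * ‖x - 0‖ / r := by
    filter_upwards [eventually_ge_atTop (2 * ‖x‖), eventually_gt_atTop 0] with r hr hr0
    have h1 : Tendsto (fun k => (c * v k x - ∫ y in ball 0 r, ker ((n : ℝ) - 4) x y * g k y) -
        (c * v k 0 - ∫ y in ball 0 r, ker ((n : ℝ) - 4) 0 y * g k y)) F (𝓝 (T r x - T r 0)) :=
      (((hw x).const_mul c).sub (hconv x r)).sub (((hw 0).const_mul c).sub (hconv 0 r))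
    have h2 : Tendsto (fun k : ℕ => K * ‖x - 0‖ / ((k : ℝ) + 1) +
        ((n : ℝ) - 4) * (4 * C1) * ‖x - 0‖ / r) F
        (𝓝 (0 + ((n : ℝ) - 4) * (4 * C1) * ‖x - 0‖ / r)) := by
      refine Tendsto.add_const _ (Tendsto.mono_left ?_ hFle)
      exact tendsto_const_nhds.div_atTop
        (tendsto_natCast_atTop_atTop.atTop_add tendsto_const_nhds)
    rw [zero_add] at h2
    refine le_of_tendsto_of_tendsto h1.abs h2 ?_
    filter_upwards [hevx x, hevx 0] with k hk hk0
    have h3 := (hE k x hk 0 hk0).2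
    have h4 := far_potential_lipschitz hn (hgm k) hr0 (hg k) (x := x) (x' := 0) (by linarith)
      (by simpa using (half_pos hr0).le) (hgi k x) (hgi k 0) (hJC k x hk) (hJC k 0 hk0)
    have h5 := integral_add_compl (measurableSet_ball (x := (0 : Eu n)) (ε := r)) (hgi k x)
    have h6 := integral_add_compl (measurableSet_ball (x := (0 : Eu n)) (ε := r)) (hgi k 0)
    rw [← h5, ← h6] at h3
    refine le_trans ?_ (add_le_add h3 h4)
    refine le_trans (le_of_eq ?_) (abs_add_le _ _)
    congr 1
    ring
  have hTt : ∀ x, Tendsto (fun r => T r x) atTop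
      (𝓝 (c * w x - ∫ y, ker ((n : ℝ) - 4) x y * w y ^ p)) := fun x =>
    (hcov.integral_tendsto_of_countably_generated (hwint x)).const_sub _
  have h0 : Tendsto (fun r : ℝ => ((n : ℝ) - 4) * (4 * C1) * ‖x - 0‖ / r) atTop (𝓝 0) :=
    tendsto_const_nhds.div_atTop tendsto_id
  have h1 := le_of_tendsto_of_tendsto ((hTt x).sub (hTt 0)).abs h0 hosc
  have h2 := abs_eq_zero.1 (le_antisymm h1 (abs_nonneg _))
  linarith

end Limit

section Constant

variable {n : ℕ}

lemma volume_real_ball (r : ℝ) (hr : 0 < r) (x : Eu n) :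
    (volume : Measure (Eu n)).real (ball x r) = r ^ n * volume.real (ball (0 : Eu n) 1) := by
  rw [measureReal_def, Measure.addHaar_ball_of_pos (volume : Measure (Eu n)) x hr,
    ENNReal.toReal_mul, ENNReal.toReal_ofReal (by positivity), finrank_euclideanSpace_fin,
    measureReal_def]

/-- Integrals of the kernel over a large ball. -/
lemma exists_setIntegral_ker_le (hn : 5 ≤ n) : ∃ C : ℝ, 0 ≤ C ∧ ∀ R : ℝ, 0 < R → ∀ y : Eu n, y ≠ 0 →
    ∫ x in ball 0 R, ker ((n : ℝ) - 4) y x ≤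
      R ^ n * (C * min (R ^ (-((n : ℝ) - 4))) (‖y‖ ^ (-((n : ℝ) - 4)))) := by
  have hn' : (5 : ℝ) ≤ n := by exact_mod_cast hn
  set m := (n : ℝ) - 4 with hm
  have hm0 : 0 ≤ m := by linarith
  set V := volume.real (ball (0 : Eu n) 1) with hV
  have hV0 : 0 ≤ V := measureReal_nonneg
  have hI0 : 0 ≤ inMass n m := inMass_nonneg _
  have h2m : (1 : ℝ) ≤ 2 ^ m := Real.one_le_rpow (by norm_num) hm0
  refine ⟨(inMass n m + V) * 2 ^ m, by positivity, ?_⟩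
  intro R hR y hy
  have hy0 : 0 < ‖y‖ := norm_pos_iff.2 hy
  have h1 := setIntegral_ker_le hn hm0 (by linarith : m < n) y (S := ball (0 : Eu n) R)
    measurableSet_ball measure_ball_lt_top.ne hR
  rw [volume_real_ball R hR, ← hV] at h1
  have hRn : R ^ ((n : ℝ) - m) = R ^ n * R ^ (-m) := by
    rw [sub_eq_add_neg, Real.rpow_add hR, Real.rpow_natCast]
  rw [hRn] at h1
  have hRm : 0 < R ^ (-m) := by positivity
  have hRnn : 0 < R ^ n := by positivity
  have h3 : ∫ x in ball 0 R, ker m y x ≤ R ^ n * ((inMass n m + V) * R ^ (-m)) := by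
    refine h1.trans_eq ?_; ring
  have half : ∀ t : ℝ, 0 < t → (t / 2) ^ (-m) = 2 ^ m * t ^ (-m) := by
    intro t ht
    rw [Real.div_rpow ht.le (by norm_num), Real.rpow_neg (by norm_num : (0 : ℝ) ≤ 2), div_inv_eq_mul,
      mul_comm]
  have hsum : 0 ≤ inMass n m + V := by positivity
  rw [mul_assoc, mul_min_of_nonneg _ _ (by positivity), mul_min_of_nonneg _ _ hsum,
    mul_min_of_nonneg _ _ hRnn.le, le_min_iff]
  constructor
  · refine h3.trans ?_
    gcongr
    nlinarith
  · by_cases hyR : ‖y‖ ≤ 2 * R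
    · refine h3.trans ?_
      gcongr
      rw [← half _ hy0]
      exact Real.rpow_le_rpow_of_nonpos (by positivity) (by linarith) (by linarith)
    · have hyR' := not_le.1 hyR
      have h4 : ∫ x in ball 0 R, ker m y x ≤ ∫ x in ball (0 : Eu n) R, (‖y‖ / 2) ^ (-m) := by
        refine setIntegral_mono_on (integrableOn_ker hn hm0 (by linarith) y
          measure_ball_lt_top.ne) (integrableOn_const measure_ball_lt_top.ne)
          measurableSet_ball fun x hx => ?_
        refine ker_le_of_le hm0 (by positivity) ?_
        have h5 : ‖x‖ < R := by simpa using hx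
        have := norm_sub_norm_le y x
        linarith
      rw [setIntegral_const, smul_eq_mul, volume_real_ball R hR, ← hV, half _ hy0] at h4
      refine h4.trans ?_
      rw [mul_assoc]
      gcongr
      linarith

lemma measurable_ker_prod (s : ℝ) : Measurable fun q : Eu n × Eu n => ker s q.1 q.2 := by
  unfold ker; fun_prop

/-- A nonnegative Riesz potential of order four that is finite everywhere is not bounded below
by a positive constant. -/
lemma exists_potential_lt (hn : 5 ≤ n) {g : Eu n → ℝ} (hgm : Measurable g) (hg : ∀ y, 0 ≤ g y)
    (hi : ∀ x, Integrable fun y => ker ((n : ℝ) - 4) x y * g y) {δ : ℝ} (hδ : 0 < δ) :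
    ∃ x, ∫ y, ker ((n : ℝ) - 4) x y * g y < δ := by
  by_contra! hcon
  have := nontrivial_eu hn
  have hn' : (5 : ℝ) ≤ n := by exact_mod_cast hn
  obtain ⟨C, hC0, hC⟩ := exists_setIntegral_ker_le hn
  set m := (n : ℝ) - 4 with hm
  set h : ℝ → Eu n → ℝ := fun R y => C * min (R ^ (-m)) (‖y‖ ^ (-m)) * g y with hh
  have hh0 : ∀ R y, 0 < R → 0 ≤ h R y := fun R y hR => by
    have := hg y
    have : 0 ≤ min (R ^ (-m)) (‖y‖ ^ (-m)) := le_min (by positivity) (by positivity)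
    positivity
  have hker0 : ∀ y : Eu n, ker m 0 y = ‖y‖ ^ (-m) := fun y => by rw [ker, zero_sub, norm_neg]
  have hdom : ∀ R y, 0 < R → ‖h R y‖ ≤ C * (ker m 0 y * g y) := fun R y hR => by
    rw [Real.norm_of_nonneg (hh0 R y hR), hker0, ← mul_assoc]
    exact mul_le_mul_of_nonneg_right (mul_le_mul_of_nonneg_left (min_le_right _ _) hC0) (hg y)
  have hhm : ∀ R, Measurable (h R) := fun R => by
    have := measurable_norm_rpow (n := n) (-m)
    exact ((measurable_const.min this).const_mul C).mul hgm
  have hhi : ∀ R, 0 < R → Integrable (h R) := fun R hR =>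
    ((hi 0).const_mul C).mono' (hhm R).aestronglyMeasurable
      (Eventually.of_forall fun y => hdom R y hR)
  have hlim : Tendsto (fun R => ∫ y, h R y) atTop (𝓝 0) := by
    have : (0 : ℝ) = ∫ _ : Eu n, (0 : ℝ) := by simp
    rw [this]
    refine tendsto_integral_filter_of_dominated_convergence (fun y => C * (ker m 0 y * g y))
      (Eventually.of_forall fun R => (hhm R).aestronglyMeasurable) ?_ ((hi 0).const_mul C) ?_
    · filter_upwards [eventually_gt_atTop 0] with R hR
      exact Eventually.of_forall fun y => hdom R y hR
    · refine Eventually.of_forall fun y => ?_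
      have h1 : Tendsto (fun R : ℝ => C * R ^ (-m) * g y) atTop (𝓝 0) := by
        have := ((tendsto_rpow_neg_atTop (by linarith : 0 < m)).const_mul C).mul_const (g y)
        simpa using this
      refine squeeze_zero' ?_ ?_ h1
      · filter_upwards [eventually_gt_atTop 0] with R hR using hh0 R y hR
      · filter_upwards [eventually_gt_atTop 0] with R hR
        have := hg y
        have : min (R ^ (-m)) (‖y‖ ^ (-m)) ≤ R ^ (-m) := min_le_left _ _
        simp only [hh]
        gcongr
  set V := volume.real (ball (0 : Eu n) 1) with hV
  have hV0 : 0 < V := 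
    ENNReal.toReal_pos (measure_ball_pos volume _ one_pos).ne' measure_ball_lt_top.ne
  have hmain : ∀ R : ℝ, 0 < R → δ * V ≤ ∫ y, h R y := by
    intro R hR
    have h1 : ∫⁻ _ in ball (0 : Eu n) R, ENNReal.ofReal δ ≤
        ∫⁻ x in ball (0 : Eu n) R, ∫⁻ y, ENNReal.ofReal (ker m x y * g y) := by
      refine lintegral_mono fun x => ?_
      simp only
      rw [← ofReal_integral_eq_lintegral_ofReal (hi x)
        (Eventually.of_forall fun y => mul_nonneg (ker_nonneg _ _ _) (hg y))]
      exact ENNReal.ofReal_le_ofReal (hcon x)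
    rw [lintegral_lintegral_swap (by
      refine Measurable.aemeasurable ?_
      exact ((measurable_ker_prod m).mul (hgm.comp measurable_snd)).ennreal_ofReal)] at h1
    have h2 : ∫⁻ y, ∫⁻ x in ball (0 : Eu n) R, ENNReal.ofReal (ker m x y * g y) ≤
        ∫⁻ y, ENNReal.ofReal (R ^ n * h R y) := by
      refine lintegral_mono_ae ?_
      filter_upwards [ae_ne hn 0] with y hy
      have hiy : IntegrableOn (fun x => ker m x y * g y) (ball 0 R) := by
        simp_rw [ker_comm m _ y]
        exact (integrableOn_ker hn (by linarith) (by linarith) y measure_ball_lt_top.ne).mul_const _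
      rw [← ofReal_integral_eq_lintegral_ofReal hiy
        (Eventually.of_forall fun x => mul_nonneg (ker_nonneg _ _ _) (hg y))]
      refine ENNReal.ofReal_le_ofReal ?_
      rw [integral_mul_const]
      simp_rw [ker_comm m _ y]
      refine (mul_le_mul_of_nonneg_right (hC R hR y hy.symm) (hg y)).trans_eq ?_
      simp only [hh]
      ring
    have h3 := h1.trans h2
    rw [← ofReal_integral_eq_lintegral_ofReal ((hhi R hR).const_mul _)
      (Eventually.of_forall fun y => mul_nonneg (by positivity) (hh0 R y hR)), setLIntegral_const,
      ← ofReal_measureReal measure_ball_lt_top.ne, ← ENNReal.ofReal_mul hδ.le,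
      integral_const_mul, ENNReal.ofReal_le_ofReal_iff
        (mul_nonneg (by positivity) (integral_nonneg fun y => hh0 R y hR)),
      volume_real_ball R hR, ← hV] at h3
    have h4 : 0 < R ^ n := by positivity
    refine le_of_mul_le_mul_left ?_ h4
    linarith
  have := ge_of_tendsto hlim (by
    filter_upwards [eventually_gt_atTop 0] with R hR using hmain R hR)
  nlinarith

/-- The additive constant in the integral equation vanishes. -/
lemma const_eq_zero (hn : 5 ≤ n) {p M c c₀ : ℝ} (hp : 1 < p) (hc : 0 < c) {w : Eu n → ℝ}
    (hwc : Continuous w) (hw : ∀ x, w x ∈ Set.Icc 0 M)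
    (hi : ∀ x, Integrable fun y => ker ((n : ℝ) - 4) x y * w y ^ p)
    (heq : ∀ x, c * w x = (∫ y, ker ((n : ℝ) - 4) x y * w y ^ p) + c₀) : c₀ = 0 := by
  have hwpm : Measurable fun y => w y ^ p := hwc.measurable.pow_const p
  have hwp0 : ∀ y, 0 ≤ w y ^ p := fun y => Real.rpow_nonneg (hw y).1 _
  rcases lt_trichotomy c₀ 0 with h | h | h
  · exfalso
    obtain ⟨x, hx⟩ := exists_potential_lt hn hwpm hwp0 hi (neg_pos.2 h)
    have := mul_nonneg hc.le (hw x).1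
    linarith [heq x]
  · exact h
  · exfalso
    have hlow : ∀ y, c₀ / c ≤ w y := fun y => by
      rw [div_le_iff₀ hc, mul_comm, heq y]
      have : 0 ≤ ∫ z, ker ((n : ℝ) - 4) y z * w z ^ p :=
        integral_nonneg fun z => mul_nonneg (ker_nonneg _ _ _) (hwp0 z)
      linarith
    have hb : 0 < c₀ / c := by positivity
    have hbp : 0 < (c₀ / c) ^ p := by positivity
    refine not_integrable_ker hn ((n : ℝ) - 4) (0 : Eu n) ?_
    refine (((hi 0).const_mul ((c₀ / c) ^ p)⁻¹)).mono' (measurable_ker _ _).aestronglyMeasurable ?_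
    refine Eventually.of_forall fun y => ?_
    rw [Real.norm_of_nonneg (ker_nonneg _ _ _), mul_comm (ker _ _ _), ← mul_assoc]
    refine le_mul_of_one_le_left (ker_nonneg _ _ _) ?_
    rw [inv_mul_eq_div, one_le_div hbp]
    exact Real.rpow_le_rpow hb.le (hlow y) (by linarith)

end Constant

section Inversion

variable {n : ℕ}

/-- Inversion in the sphere of radius `l` centred at the origin. -/
noncomputable def inv (l : ℝ) (z : Eu n) : Eu n := (l / ‖z‖) ^ 2 • z

lemma inv_eq (l : ℝ) : (inv l : Eu n → Eu n) = EuclideanGeometry.inversion 0 l := by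
  ext1 z
  simp [inv, EuclideanGeometry.inversion]

lemma norm_inv_eq (l : ℝ) (z : Eu n) : ‖inv l z‖ = l ^ 2 / ‖z‖ := by
  have := EuclideanGeometry.dist_inversion_center (0 : Eu n) z l
  rwa [← inv_eq, dist_zero_right, dist_zero_right] at this

lemma inv_inv_eq {l : ℝ} (hl : 0 < l) (z : Eu n) : inv l (inv l z) = z := by
  rw [inv_eq]
  exact EuclideanGeometry.inversion_inversion _ hl.ne' z

lemma inv_ne_zero' {l : ℝ} (hl : 0 < l) {z : Eu n} (hz : z ≠ 0) : inv l z ≠ 0 := by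
  have : 0 < ‖z‖ := norm_pos_iff.2 hz
  rw [← norm_pos_iff, norm_inv_eq]
  positivity

lemma norm_sub_inv {l : ℝ} (hl : 0 < l) {x w : Eu n} (hx : x ≠ 0) (hw : w ≠ 0) :
    ‖x - inv l w‖ = ‖x‖ / ‖w‖ * ‖inv l x - w‖ := by
  have h := EuclideanGeometry.dist_inversion_inversion (c := (0 : Eu n)) (inv_ne_zero' hl hx) hw l
  have hx0 : 0 < ‖x‖ := norm_pos_iff.2 hx
  have hw0 : 0 < ‖w‖ := norm_pos_iff.2 hw
  rw [← inv_eq, inv_inv_eq hl, dist_zero_right, dist_zero_right, norm_inv_eq, dist_eq_norm,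
    dist_eq_norm] at h
  rw [h]
  field_simp

lemma norm_gap {l : ℝ} {x : Eu n} (hx : x ≠ 0) (z : Eu n) :
    ‖x‖ ^ 2 * ‖inv l x - z‖ ^ 2 - l ^ 2 * ‖x - z‖ ^ 2 = (‖x‖ ^ 2 - l ^ 2) * (‖z‖ ^ 2 - l ^ 2) := by
  have hx0 : 0 < ‖x‖ := norm_pos_iff.2 hx
  rw [norm_sub_sq_real, norm_sub_sq_real, norm_inv_eq, inv, real_inner_smul_left]
  field_simp
  ring

lemma mem_ext {l : ℝ} {z : Eu n} : z ∈ (closedBall (0 : Eu n) l)ᶜ ↔ l < ‖z‖ := by simp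

lemma image_inv {l : ℝ} (hl : 0 < l) :
    inv l '' (closedBall (0 : Eu n) l)ᶜ = ball 0 l \ {0} := by
  ext y
  constructor
  · rintro ⟨z, hz, rfl⟩
    have hz' := mem_ext.1 hz
    have hz0 : z ≠ 0 := norm_pos_iff.1 (hl.trans hz')
    refine ⟨?_, inv_ne_zero' hl hz0⟩
    rw [mem_ball_zero_iff, norm_inv_eq, div_lt_iff₀ (hl.trans hz'), pow_two]
    exact mul_lt_mul_of_pos_left hz' hl
  · rintro ⟨hy, hy0⟩
    have hy' := mem_ball_zero_iff.1 hy
    have hy0' : 0 < ‖y‖ := norm_pos_iff.2 hy0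
    refine ⟨inv l y, ?_, inv_inv_eq hl y⟩
    rw [mem_ext, norm_inv_eq, lt_div_iff₀ hy0', pow_two]
    exact mul_lt_mul_of_pos_left hy' hl

lemma abs_det_inv (l : ℝ) (z : Eu n) :
    |((l / dist z 0) ^ 2 • ((ℝ ∙ (z - 0))ᗮ.reflection : Eu n →L[ℝ] Eu n)).det| =
      (l / ‖z‖) ^ (2 * n) := by
  have h1 : |LinearMap.det (ℝ ∙ (z - 0))ᗮ.reflection.toLinearMap| = 1 := by
    rw [Submodule.det_reflection, abs_pow, abs_neg, abs_one, one_pow]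
  rw [ContinuousLinearMap.det]
  have h2 : (((l / dist z 0) ^ 2 • ((ℝ ∙ (z - 0))ᗮ.reflection : Eu n →L[ℝ] Eu n) :
      Eu n →L[ℝ] Eu n) : Eu n →ₗ[ℝ] Eu n) =
      (l / dist z 0) ^ 2 • (ℝ ∙ (z - 0))ᗮ.reflection.toLinearMap := rfl
  rw [h2, LinearMap.det_smul, abs_mul, h1, mul_one, finrank_euclideanSpace_fin, dist_zero_right,
    ← pow_mul, abs_of_nonneg]
  exact (even_two.mul_right n).pow_nonneg _

/-- Change of variables under inversion. -/
lemma setIntegral_ball_eq_inv (hn : 5 ≤ n) {l : ℝ} (hl : 0 < l) (f : Eu n → ℝ) :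
    (IntegrableOn f (ball 0 l) ↔
      IntegrableOn (fun z => (l / ‖z‖) ^ (2 * n) * f (inv l z)) (closedBall 0 l)ᶜ) ∧
    ∫ z in ball 0 l, f z = ∫ z in (closedBall 0 l)ᶜ, (l / ‖z‖) ^ (2 * n) * f (inv l z) := by
  have := nontrivial_eu hn
  have hd : ∀ z ∈ (closedBall (0 : Eu n) l)ᶜ, HasFDerivWithinAt (inv l)
      ((l / dist z 0) ^ 2 • ((ℝ ∙ (z - 0))ᗮ.reflection : Eu n →L[ℝ] Eu n))
      (closedBall (0 : Eu n) l)ᶜ z := by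
    intro z hz
    rw [inv_eq]
    exact (EuclideanGeometry.hasFDerivAt_inversion
      (norm_pos_iff.1 (hl.trans (mem_ext.1 hz)))).hasFDerivWithinAt
  have hinj : Set.InjOn (inv l : Eu n → Eu n) (closedBall (0 : Eu n) l)ᶜ := by
    rw [inv_eq]
    exact (EuclideanGeometry.inversion_injective _ hl.ne').injOn
  have hae : (ball (0 : Eu n) l \ {0} : Set (Eu n)) =ᵐ[volume] ball (0 : Eu n) l :=
    sdiff_null_ae_eq_self (measure_singleton 0)
  have h1 := integrableOn_image_iff_integrableOn_abs_det_fderiv_smul (volume : Measure (Eu n))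
    measurableSet_closedBall.compl hd hinj f
  have h2 := integral_image_eq_integral_abs_det_fderiv_smul (volume : Measure (Eu n))
    measurableSet_closedBall.compl hd hinj f
  rw [image_inv hl] at h1 h2
  simp only [abs_det_inv, smul_eq_mul] at h1 h2
  rw [integrableOn_congr_set_ae hae] at h1
  rw [setIntegral_congr_set hae] at h2
  exact ⟨h1, h2⟩

end Inversion

section Spheres

variable {n : ℕ}

/-- Bounded positive entire solutions of the integral equation `v = a |x|^{4-n} * v^p`. -/
structure IsIntegralSol (n : ℕ) (p M a : ℝ) (v : Eu n → ℝ) : Prop where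
  five_le : 5 ≤ n
  one_lt : 1 < p
  subcritical : ((n : ℝ) - 4) * p < n + 4
  coeff_pos : 0 < a
  continuous : Continuous v
  pos : ∀ x, 0 < v x
  le : ∀ x, v x ≤ M
  integrable : ∀ x, Integrable fun y => ker ((n : ℝ) - 4) x y * v y ^ p
  eq : ∀ x, v x = a * ∫ y, ker ((n : ℝ) - 4) x y * v y ^ p

/-- The Kelvin transform of `v` in the sphere of radius `l`. -/
noncomputable def kel (l : ℝ) (v : Eu n → ℝ) (z : Eu n) : ℝ :=
  (l / ‖z‖) ^ ((n : ℝ) - 4) * v (inv l z)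

/-- The right-hand side of the equation transplanted by inversion. -/
noncomputable def src (p l : ℝ) (v : Eu n → ℝ) (z : Eu n) : ℝ :=
  (l / ‖z‖) ^ ((n : ℝ) + 4) * v (inv l z) ^ p

/-- The kernel of the moving spheres identity. -/
noncomputable def sphereKer (l : ℝ) (x z : Eu n) : ℝ :=
  ker ((n : ℝ) - 4) x z - (l / ‖x‖) ^ ((n : ℝ) - 4) * ker ((n : ℝ) - 4) (inv l x) z

variable {p M a : ℝ} {v : Eu n → ℝ}

lemma ker_inv_eq {l : ℝ} (hl : 0 < l) {x z : Eu n} (hx : x ≠ 0) (hz : z ≠ 0) :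
    (l / ‖z‖) ^ (2 * n) * (ker ((n : ℝ) - 4) x (inv l z) * v (inv l z) ^ p) =
      (l / ‖x‖) ^ ((n : ℝ) - 4) * (ker ((n : ℝ) - 4) (inv l x) z * src p l v z) := by
  have hx0 : 0 < ‖x‖ := norm_pos_iff.2 hx
  have hz0 : 0 < ‖z‖ := norm_pos_iff.2 hz
  have h1 : ker ((n : ℝ) - 4) x (inv l z) =
      (l / ‖x‖) ^ ((n : ℝ) - 4) * (l / ‖z‖) ^ (-((n : ℝ) - 4)) * ker ((n : ℝ) - 4) (inv l x) z := by
    have h2 : ‖x‖ / ‖z‖ = (l / ‖z‖) / (l / ‖x‖) := by field_simp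
    rw [ker, norm_sub_inv hl hx hz, Real.mul_rpow (by positivity) (norm_nonneg _), h2,
      Real.div_rpow (by positivity) (by positivity), Real.rpow_neg (by positivity : 0 ≤ l / ‖x‖),
      div_inv_eq_mul, mul_comm ((l / ‖z‖) ^ _), ker]
  have h3 : (l / ‖z‖) ^ (2 * n) * (l / ‖z‖) ^ (-((n : ℝ) - 4)) = (l / ‖z‖) ^ ((n : ℝ) + 4) := by
    rw [← Real.rpow_natCast, ← Real.rpow_add (by positivity)]
    congr 1
    push_cast
    ring
  rw [h1, src, ← h3]
  ring

namespace IsIntegralSol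

lemma ball_eq (hv : IsIntegralSol n p M a v) {l : ℝ} (hl : 0 < l) {x : Eu n} (hx : x ≠ 0) :
    IntegrableOn (fun z => ker ((n : ℝ) - 4) (inv l x) z * src p l v z) (closedBall 0 l)ᶜ ∧
    ∫ z in ball 0 l, ker ((n : ℝ) - 4) x z * v z ^ p =
      (l / ‖x‖) ^ ((n : ℝ) - 4) *
        ∫ z in (closedBall 0 l)ᶜ, ker ((n : ℝ) - 4) (inv l x) z * src p l v z := by
  have hx0 : 0 < ‖x‖ := norm_pos_iff.2 hx
  have h := setIntegral_ball_eq_inv hv.five_le hl (fun z => ker ((n : ℝ) - 4) x z * v z ^ p)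
  have hcongr : Set.EqOn
      (fun z => (l / ‖z‖) ^ (2 * n) * (ker ((n : ℝ) - 4) x (inv l z) * v (inv l z) ^ p))
      (fun z => (l / ‖x‖) ^ ((n : ℝ) - 4) * (ker ((n : ℝ) - 4) (inv l x) z * src p l v z))
      (closedBall 0 l)ᶜ := fun z hz =>
    ker_inv_eq hl hx (norm_pos_iff.1 (hl.trans (mem_ext.1 hz)))
  constructor
  · have h1 := h.1.1 (hv.integrable x).integrableOn
    rw [integrableOn_congr_fun hcongr measurableSet_closedBall.compl] at h1
    have hne : (l / ‖x‖) ^ ((n : ℝ) - 4) ≠ 0 := by positivity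
    exact (integrable_const_mul_iff hne.isUnit _).1 h1
  · rw [h.2, setIntegral_congr_fun measurableSet_closedBall.compl hcongr, integral_const_mul]

lemma integral_split (hv : IsIntegralSol n p M a v) (l : ℝ) (x : Eu n) :
    v x = a * ((∫ z in ball 0 l, ker ((n : ℝ) - 4) x z * v z ^ p) +
      ∫ z in (closedBall 0 l)ᶜ, ker ((n : ℝ) - 4) x z * v z ^ p) := by
  have := nontrivial_eu hv.five_le
  have hae : (ball (0 : Eu n) l : Set (Eu n)) =ᵐ[volume] closedBall (0 : Eu n) l := by
    rw [← closedBall_sdiff_sphere]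
    exact sdiff_null_ae_eq_self (Measure.addHaar_sphere volume 0 l)
  rw [setIntegral_congr_set hae, integral_add_compl measurableSet_closedBall (hv.integrable x),
    ← hv.eq]

/-- The moving spheres identity. -/
lemma sub_kel_eq (hv : IsIntegralSol n p M a v) {l : ℝ} (hl : 0 < l) {x : Eu n} (hx : x ≠ 0) :
    IntegrableOn (fun z => sphereKer l x z * (v z ^ p - src p l v z)) (closedBall 0 l)ᶜ ∧
    v x - kel l v x = a * ∫ z in (closedBall 0 l)ᶜ, sphereKer l x z * (v z ^ p - src p l v z) := by
  have hx0 : 0 < ‖x‖ := norm_pos_iff.2 hx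
  have hix := inv_ne_zero' hl hx
  obtain ⟨i1, e1⟩ := hv.ball_eq hl hx
  obtain ⟨i2, e2⟩ := hv.ball_eq hl hix
  rw [inv_inv_eq hl] at i2 e2
  have i3 := (hv.integrable x).integrableOn (s := (closedBall (0 : Eu n) l)ᶜ)
  have i4 := (hv.integrable (inv l x)).integrableOn (s := (closedBall (0 : Eu n) l)ᶜ)
  set t := (l / ‖x‖) ^ ((n : ℝ) - 4) with ht
  have ht' : t * (l / ‖inv l x‖) ^ ((n : ℝ) - 4) = 1 := by
    rw [ht, ← Real.mul_rpow (by positivity) (by positivity), norm_inv_eq]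
    have : l / ‖x‖ * (l / (l ^ 2 / ‖x‖)) = 1 := by field_simp
    rw [this, Real.one_rpow]
  have hfun : (fun z => sphereKer l x z * (v z ^ p - src p l v z)) = fun z =>
      (ker ((n : ℝ) - 4) x z * v z ^ p + t * (ker ((n : ℝ) - 4) (inv l x) z * src p l v z)) -
      (t * (ker ((n : ℝ) - 4) (inv l x) z * v z ^ p) + ker ((n : ℝ) - 4) x z * src p l v z) := by
    ext z
    rw [sphereKer]
    ring
  have j1 : IntegrableOn (fun z => ker ((n : ℝ) - 4) x z * v z ^ p +
      t * (ker ((n : ℝ) - 4) (inv l x) z * src p l v z)) (closedBall 0 l)ᶜ :=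
    i3.add (i1.const_mul t)
  have j2 : IntegrableOn (fun z => t * (ker ((n : ℝ) - 4) (inv l x) z * v z ^ p) +
      ker ((n : ℝ) - 4) x z * src p l v z) (closedBall 0 l)ᶜ :=
    (i4.const_mul t).add i2
  rw [hfun]
  refine ⟨j1.sub j2, ?_⟩
  rw [integral_sub j1 j2, integral_add i3 (i1.const_mul t), integral_add (i4.const_mul t) i2,
    integral_const_mul, integral_const_mul, kel, hv.integral_split l x,
    hv.integral_split l (inv l x), e1, e2]
  linear_combination (-a * ∫ z in (closedBall 0 l)ᶜ, ker ((n : ℝ) - 4) x z * src p l v z) * ht'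

end IsIntegralSol

lemma ker_inv_lt (hn : 5 ≤ n) {l : ℝ} (hl : 0 < l) {x z : Eu n} (hx : l < ‖x‖) (hz : l < ‖z‖)
    (hxz : x ≠ z) : 0 < sphereKer l x z := by
  have hn' : (5 : ℝ) ≤ n := by exact_mod_cast hn
  have hx0 : 0 < ‖x‖ := hl.trans hx
  have hxz0 : 0 < ‖x - z‖ := by simpa [sub_eq_zero] using hxz
  have hgap := norm_gap (l := l) (norm_pos_iff.1 hx0) z
  have h1 : 0 < (‖x‖ ^ 2 - l ^ 2) * (‖z‖ ^ 2 - l ^ 2) :=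
    mul_pos (by nlinarith) (by nlinarith)
  have h2 : l * ‖x - z‖ < ‖x‖ * ‖inv l x - z‖ := by
    refine lt_of_pow_lt_pow_left₀ 2 (by positivity) ?_
    rw [mul_pow, mul_pow]
    linarith
  have h3 : ‖x - z‖ < (l / ‖x‖)⁻¹ * ‖inv l x - z‖ := by
    rw [inv_div, div_mul_eq_mul_div, lt_div_iff₀ hl, mul_comm]
    exact h2
  have h4 : ((l / ‖x‖)⁻¹ * ‖inv l x - z‖) ^ (-((n : ℝ) - 4)) < ‖x - z‖ ^ (-((n : ℝ) - 4)) :=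
    Real.rpow_lt_rpow_of_neg hxz0 h3 (by linarith)
  rw [Real.mul_rpow (by positivity) (norm_nonneg _), Real.inv_rpow (by positivity),
    Real.rpow_neg (by positivity : 0 ≤ l / ‖x‖), inv_inv] at h4
  rw [sphereKer, ker, ker]
  linarith

lemma sphereKer_le {l : ℝ} (hl : 0 < l) (x z : Eu n) :
    sphereKer l x z ≤ ker ((n : ℝ) - 4) x z := by
  rw [sphereKer]
  have := ker_nonneg ((n : ℝ) - 4) (inv l x) z
  have : 0 ≤ (l / ‖x‖) ^ ((n : ℝ) - 4) := by positivity
  nlinarith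

end Spheres

section MovingSpheres

variable {n : ℕ} {p M a : ℝ} {v : Eu n → ℝ}

lemma continuous_kel_radius (hn : 5 ≤ n) (hv : Continuous v) (z : Eu n) :
    Continuous fun l : ℝ => kel l v z := by
  have hn' : (5 : ℝ) ≤ n := by exact_mod_cast hn
  unfold kel inv
  refine Continuous.mul ((continuous_id.div_const _).rpow_const fun _ => Or.inr ?_) ?_
  · linarith
  · fun_prop

lemma measurable_kel (hv : Continuous v) (l : ℝ) : Measurable (kel l v) := by
  unfold kel inv
  have := hv.measurable
  fun_prop

/-- The set where the Kelvin transform exceeds the function. -/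
def bad (l : ℝ) (v : Eu n → ℝ) : Set (Eu n) := {z | l < ‖z‖ ∧ v z < kel l v z}

lemma measurableSet_bad (hv : Continuous v) (l : ℝ) : MeasurableSet (bad l v) :=
  (measurableSet_lt measurable_const measurable_norm).inter
    (measurableSet_lt hv.measurable (measurable_kel hv l))

lemma bad_subset (l : ℝ) : bad l v ⊆ (closedBall (0 : Eu n) l)ᶜ := fun _ hz => mem_ext.2 hz.1

namespace IsIntegralSol

lemma bound_pos (hv : IsIntegralSol n p M a v) : 0 < M := (hv.pos 0).trans_le (hv.le 0)

lemma kel_pos (hv : IsIntegralSol n p M a v) {l : ℝ} (hl : 0 < l) {z : Eu n} (hz : l < ‖z‖) :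
    0 < kel l v z := by
  have := hv.pos (inv l z)
  have : 0 < ‖z‖ := hl.trans hz
  unfold kel
  positivity

lemma src_eq (hv : IsIntegralSol n p M a v) {l : ℝ} (hl : 0 < l) {z : Eu n} (hz : l < ‖z‖) :
    src p l v z = (l / ‖z‖) ^ ((n : ℝ) + 4 - (n - 4) * p) * kel l v z ^ p := by
  have := hv.pos (inv l z)
  have hz0 : 0 < ‖z‖ := hl.trans hz
  rw [src, kel, Real.mul_rpow (by positivity) this.le, ← Real.rpow_mul (by positivity), ← mul_assoc,
    ← Real.rpow_add (by positivity)]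
  ring_nf

lemma src_lt (hv : IsIntegralSol n p M a v) {l : ℝ} (hl : 0 < l) {z : Eu n} (hz : l < ‖z‖)
    (h : kel l v z ≤ v z) : src p l v z < v z ^ p := by
  have hz0 : 0 < ‖z‖ := hl.trans hz
  have hk := hv.kel_pos hl hz
  have hkp : 0 < kel l v z ^ p := by positivity
  rw [hv.src_eq hl hz]
  have h1 : (l / ‖z‖) ^ ((n : ℝ) + 4 - (n - 4) * p) < 1 :=
    Real.rpow_lt_one (by positivity) ((div_lt_one hz0).2 hz) (by linarith [hv.subcritical])
  have h2 : kel l v z ^ p ≤ v z ^ p := Real.rpow_le_rpow hk.le h (by linarith [hv.one_lt])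
  nlinarith

lemma src_sub_le (hv : IsIntegralSol n p M a v) {l : ℝ} (hl : 0 < l) {z : Eu n} (hz : l < ‖z‖)
    (h : v z < kel l v z) :
    src p l v z - v z ^ p ≤ p * M ^ (p - 1) * l ^ 8 * ‖z‖ ^ (-(8 : ℝ)) * (kel l v z - v z) := by
  have hz0 : 0 < ‖z‖ := hl.trans hz
  have hM := hv.bound_pos
  have hk := hv.kel_pos hl hz
  set t := l / ‖z‖ with ht
  have ht0 : 0 < t := by positivity
  have hkM : kel l v z ≤ t ^ ((n : ℝ) - 4) * M :=
    mul_le_mul_of_nonneg_left (hv.le _) (by positivity)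
  have h1 : t ^ ((n : ℝ) + 4 - (n - 4) * p) ≤ 1 :=
    Real.rpow_le_one ht0.le ((div_le_one hz0).2 hz.le) (by linarith [hv.subcritical])
  have h2 := (le_abs_self _).trans (abs_rpow_sub_rpow_le hv.one_lt ⟨hk.le, hkM⟩
    ⟨(hv.pos z).le, h.le.trans hkM⟩)
  rw [abs_of_pos (sub_pos.2 h)] at h2
  have h3 : 0 ≤ v z ^ p := Real.rpow_nonneg (hv.pos z).le _
  have h4 : t ^ ((n : ℝ) + 4 - (n - 4) * p) * (t ^ ((n : ℝ) - 4) * M) ^ (p - 1) =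
      l ^ 8 * ‖z‖ ^ (-(8 : ℝ)) * M ^ (p - 1) := by
    rw [Real.mul_rpow (by positivity) hM.le, ← Real.rpow_mul ht0.le, ← mul_assoc,
      ← Real.rpow_add ht0]
    congr 1
    rw [show (n : ℝ) + 4 - (n - 4) * p + (n - 4) * (p - 1) = (8 : ℕ) by push_cast; ring,
      Real.rpow_natCast, Real.rpow_neg hz0.le, ht, div_pow]
    norm_cast
  rw [hv.src_eq hl hz]
  calc t ^ ((n : ℝ) + 4 - (n - 4) * p) * kel l v z ^ p - v z ^ p
      ≤ t ^ ((n : ℝ) + 4 - (n - 4) * p) * (kel l v z ^ p - v z ^ p) := by nlinarith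
    _ ≤ t ^ ((n : ℝ) + 4 - (n - 4) * p) *
        (p * (t ^ ((n : ℝ) - 4) * M) ^ (p - 1) * (kel l v z - v z)) :=
        mul_le_mul_of_nonneg_left h2 (by positivity)
    _ = p * (t ^ ((n : ℝ) + 4 - (n - 4) * p) * (t ^ ((n : ℝ) - 4) * M) ^ (p - 1)) *
        (kel l v z - v z) := by ring
    _ = _ := by rw [h4]; ring

lemma integrableOn_weight (hn : 5 ≤ n) {l : ℝ} (hl : 0 < l) (x : Eu n) :
    IntegrableOn (fun z => ker ((n : ℝ) - 4) x z * ‖z‖ ^ (-(8 : ℝ))) (ball 0 l)ᶜ ∧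
    ∫ z in (ball 0 l)ᶜ, ker ((n : ℝ) - 4) x z * ‖z‖ ^ (-(8 : ℝ)) ≤
      tailConst n (n - 4) 8 * (l ^ 4)⁻¹ := by
  have hn' : (5 : ℝ) ≤ n := by exact_mod_cast hn
  have h := integrableOn_ker_mul_tail hn (s := (n : ℝ) - 4) (t := 8) (by linarith) (by linarith)
    (by norm_num) (by linarith) x hl
  refine ⟨h.1, h.2.trans_eq ?_⟩
  rw [show (n : ℝ) - (n - 4) - 8 = -(4 : ℕ) by push_cast; ring, Real.rpow_neg hl.le,
    Real.rpow_natCast]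

lemma compl_closedBall_subset (l : ℝ) : (closedBall (0 : Eu n) l)ᶜ ⊆ (ball 0 l)ᶜ :=
  Set.compl_subset_compl.2 ball_subset_closedBall

/-- The narrow-domain form of the maximum principle for the moving spheres identity. -/
lemma kel_le_of_weight_le (hv : IsIntegralSol n p M a v) {l : ℝ} (hl : 0 < l)
    (h : ∀ x, l < ‖x‖ → a * (p * M ^ (p - 1)) * l ^ 8 *
      ∫ z in bad l v, ker ((n : ℝ) - 4) x z * ‖z‖ ^ (-(8 : ℝ)) ≤ 1 / 2) :
    ∀ z, l < ‖z‖ → kel l v z ≤ v z := by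
  have hM := hv.bound_pos
  have hp := hv.one_lt
  have ha := hv.coeff_pos
  have step : ∀ W : ℝ, 0 ≤ W → (∀ z, l < ‖z‖ → kel l v z - v z ≤ W) →
      ∀ z, l < ‖z‖ → kel l v z - v z ≤ W / 2 := by
    intro W hW hle x hx
    obtain ⟨hi, he⟩ := hv.sub_kel_eq hl (norm_pos_iff.1 (hl.trans hx))
    set f : Eu n → ℝ := fun z => ker ((n : ℝ) - 4) x z * ‖z‖ ^ (-(8 : ℝ)) with hf
    have hfi : IntegrableOn f (bad l v) := (integrableOn_weight hv.five_le hl x).1.mono_set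
      ((bad_subset l).trans (compl_closedBall_subset l))
    have hb := measurableSet_bad hv.continuous l
    have hpt : ∀ᵐ z, z ∈ (closedBall (0 : Eu n) l)ᶜ → -(sphereKer l x z * (v z ^ p - src p l v z)) ≤
        (bad l v).indicator (fun z => p * M ^ (p - 1) * l ^ 8 * W * f z) z := by
      filter_upwards [ae_ne hv.five_le x] with z hzx hz
      have hz' := mem_ext.1 hz
      have hs := (ker_inv_lt hv.five_le hl hx hz' hzx).le
      have hsk := sphereKer_le hl x z
      by_cases hzb : z ∈ bad l v
      · rw [Set.indicator_of_mem hzb]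
        have h1 := hv.src_sub_le hl hz' hzb.2
        have h2 := hle z hz'
        have h3 : 0 ≤ p * M ^ (p - 1) * l ^ 8 * ‖z‖ ^ (-(8 : ℝ)) := by positivity
        have h4 : src p l v z - v z ^ p ≤ p * M ^ (p - 1) * l ^ 8 * ‖z‖ ^ (-(8 : ℝ)) * W :=
          h1.trans (mul_le_mul_of_nonneg_left h2 h3)
        calc -(sphereKer l x z * (v z ^ p - src p l v z))
            = sphereKer l x z * (src p l v z - v z ^ p) := by ring
          _ ≤ sphereKer l x z * (p * M ^ (p - 1) * l ^ 8 * ‖z‖ ^ (-(8 : ℝ)) * W) :=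
            mul_le_mul_of_nonneg_left h4 hs
          _ ≤ ker ((n : ℝ) - 4) x z * (p * M ^ (p - 1) * l ^ 8 * ‖z‖ ^ (-(8 : ℝ)) * W) :=
            mul_le_mul_of_nonneg_right hsk (by positivity)
          _ = _ := by simp only [hf]; ring
      · rw [Set.indicator_of_notMem hzb]
        have h1 : kel l v z ≤ v z := not_lt.1 fun hlt => hzb ⟨hz', hlt⟩
        have h2 := hv.src_lt hl hz' h1
        nlinarith
    have h1 : ∫ z in (closedBall (0 : Eu n) l)ᶜ, -(sphereKer l x z * (v z ^ p - src p l v z)) ≤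
        ∫ z in (closedBall (0 : Eu n) l)ᶜ,
          (bad l v).indicator (fun z => p * M ^ (p - 1) * l ^ 8 * W * f z) z := by
      refine setIntegral_mono_on_ae hi.neg ?_ measurableSet_closedBall.compl hpt
      exact ((integrable_indicator_iff hb).2 (hfi.const_mul _)).integrableOn
    rw [integral_neg, setIntegral_indicator hb, Set.inter_eq_right.2 (bad_subset l),
      integral_const_mul] at h1
    have h2 := mul_le_mul_of_nonneg_left h1 ha.le
    have h3 := mul_le_mul_of_nonneg_left (h x hx) hW
    linarith
  have hk : ∀ k : ℕ, ∀ z, l < ‖z‖ → kel l v z - v z ≤ M * (1 / 2) ^ k := by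
    intro k
    induction k with
    | zero =>
      intro z hz
      have hz0 : 0 < ‖z‖ := hl.trans hz
      have : (5 : ℝ) ≤ n := by exact_mod_cast hv.five_le
      have h1 : (l / ‖z‖) ^ ((n : ℝ) - 4) ≤ 1 :=
        Real.rpow_le_one (by positivity) ((div_le_one hz0).2 hz.le) (by linarith)
      have h2 : kel l v z ≤ 1 * M :=
        mul_le_mul h1 (hv.le _) (hv.pos _).le zero_le_one
      have := hv.pos z
      simp only [pow_zero, mul_one]
      linarith
    | succ k ih =>
      intro z hz
      have := step _ (by positivity) ih z hz
      rw [pow_succ]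
      linarith
  intro z hz
  have hlim : Tendsto (fun k : ℕ => M * (1 / 2 : ℝ) ^ k) atTop (𝓝 (M * 0)) :=
    (tendsto_pow_atTop_nhds_zero_of_lt_one (by norm_num) (by norm_num)).const_mul M
  have := ge_of_tendsto' hlim fun k => hk k z hz
  linarith

/-- On a good sphere the comparison is strict. -/
lemma kel_lt (hv : IsIntegralSol n p M a v) {l : ℝ} (hl : 0 < l)
    (h : ∀ z, l < ‖z‖ → kel l v z ≤ v z) {x : Eu n} (hx : l < ‖x‖) : kel l v x < v x := by
  obtain ⟨hi, he⟩ := hv.sub_kel_eq hl (norm_pos_iff.1 (hl.trans hx))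
  have hpt : ∀ z ∈ (closedBall (0 : Eu n) l)ᶜ, x ≠ z →
      0 < sphereKer l x z * (v z ^ p - src p l v z) := fun z hz hxz =>
    mul_pos (ker_inv_lt hv.five_le hl hx (mem_ext.1 hz) hxz)
      (sub_pos.2 (hv.src_lt hl (mem_ext.1 hz) (h z (mem_ext.1 hz))))
  have hae : ∀ᵐ z ∂(volume.restrict (closedBall (0 : Eu n) l)ᶜ),
      0 < sphereKer l x z * (v z ^ p - src p l v z) := by
    rw [ae_restrict_iff' measurableSet_closedBall.compl]
    filter_upwards [ae_ne hv.five_le x] with z hxz hz using hpt z hz hxz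
  have hpos : 0 < ∫ z in (closedBall (0 : Eu n) l)ᶜ,
      sphereKer l x z * (v z ^ p - src p l v z) := by
    rw [integral_pos_iff_support_of_nonneg_ae (hae.mono fun z hz => hz.le) hi]
    have hsup : (volume.restrict (closedBall (0 : Eu n) l)ᶜ)
        (Function.support fun z => sphereKer l x z * (v z ^ p - src p l v z)) =
        (volume.restrict (closedBall (0 : Eu n) l)ᶜ) Set.univ :=
      measure_congr (by filter_upwards [hae] with z hz using propext ⟨fun _ => trivial, fun _ => hz.ne'⟩)
    rw [hsup, Measure.restrict_apply_univ]
    exact isClosed_closedBall.isOpen_compl.measure_pos _ ⟨x, mem_ext.2 hx⟩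
  have := mul_pos hv.coeff_pos hpos
  linarith

lemma exists_small_good (hv : IsIntegralSol n p M a v) :
    ∃ l₀ : ℝ, 0 < l₀ ∧ ∀ l, 0 < l → l ≤ l₀ → ∀ z, l < ‖z‖ → kel l v z ≤ v z := by
  have hM := hv.bound_pos
  have hp := hv.one_lt
  have ha := hv.coeff_pos
  have hT := tailConst_nonneg (n := n) (n - 4) 8
  set c := a * (p * M ^ (p - 1)) * tailConst n (n - 4) 8 with hc
  have hlim : Tendsto (fun l : ℝ => c * l ^ 4) (𝓝 0) (𝓝 (c * 0 ^ 4)) := by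
    refine Continuous.tendsto ?_ 0
    fun_prop
  have hev : ∀ᶠ l : ℝ in 𝓝 0, c * l ^ 4 < 1 / 2 := hlim.eventually_lt_const (by norm_num)
  obtain ⟨ε, hε, hball⟩ := Metric.eventually_nhds_iff.1 hev
  refine ⟨ε / 2, by positivity, fun l hl hle => hv.kel_le_of_weight_le hl fun x hx => ?_⟩
  have h1 : c * l ^ 4 < 1 / 2 := hball (by rw [Real.dist_0_eq_abs, abs_of_pos hl]; linarith)
  obtain ⟨i1, i2⟩ := integrableOn_weight hv.five_le hl x
  have h2 : ∫ z in bad l v, ker ((n : ℝ) - 4) x z * ‖z‖ ^ (-(8 : ℝ)) ≤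
      tailConst n (n - 4) 8 * (l ^ 4)⁻¹ :=
    (setIntegral_mono_set i1 (Eventually.of_forall fun z =>
      mul_nonneg (ker_nonneg _ _ _) (Real.rpow_nonneg (norm_nonneg _) _))
      ((bad_subset l).trans (compl_closedBall_subset l)).eventuallyLE).trans i2
  have h3 := mul_le_mul_of_nonneg_left h2 (by positivity : 0 ≤ a * (p * M ^ (p - 1)) * l ^ 8)
  refine h3.trans (le_of_eq_of_le ?_ h1.le)
  rw [hc]
  field_simp

lemma tendsto_measure_bad (hv : IsIntegralSol n p M a v) {l : ℝ} (hl : 0 < l)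
    (h : ∀ z, l < ‖z‖ → kel l v z ≤ v z) (R : ℝ) :
    Tendsto (fun s => volume.real (bad s v ∩ ball 0 R)) (𝓝[>] l) (𝓝 0) := by
  have h1 : Tendsto (fun s => volume (bad s v ∩ ball 0 R)) (𝓝[>] l) (𝓝 (volume (∅ : Set (Eu n)))) := by
    refine tendsto_measure_of_tendsto_indicator (𝓝[>] l) (B := ball 0 R)
      (fun s => (measurableSet_bad hv.continuous s).inter measurableSet_ball) measurableSet_ball
      measure_ball_lt_top.ne (Eventually.of_forall fun s => Set.inter_subset_right) fun z => ?_
    rcases le_or_gt ‖z‖ l with hz | hz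
    · filter_upwards [self_mem_nhdsWithin] with s hs
      refine iff_of_false (fun hm => ?_) (Set.notMem_empty z)
      exact absurd hm.1.1 (not_lt.2 (hz.trans (le_of_lt hs)))
    · have h2 : ∀ᶠ s in 𝓝 l, kel s v z < v z :=
        ((continuous_kel_radius hv.five_le hv.continuous z).tendsto l).eventually_lt_const
          (hv.kel_lt hl h hz)
      filter_upwards [h2.filter_mono nhdsWithin_le_nhds] with s hs
      exact iff_of_false (fun hm => absurd hm.1.2 hs.not_gt) (Set.notMem_empty z)
  have h2 := (ENNReal.tendsto_toReal (by simp)).comp h1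
  rw [measure_empty, ENNReal.toReal_zero] at h2
  exact h2

lemma eventually_good (hv : IsIntegralSol n p M a v) {l : ℝ} (hl : 0 < l)
    (h : ∀ z, l < ‖z‖ → kel l v z ≤ v z) :
    ∀ᶠ s in 𝓝[>] l, ∀ z, s < ‖z‖ → kel s v z ≤ v z := by
  have hn' : (5 : ℝ) ≤ n := by exact_mod_cast hv.five_le
  have hM := hv.bound_pos
  have hp := hv.one_lt
  have ha := hv.coeff_pos
  have hT := tailConst_nonneg (n := n) (n - 4) 8
  set c := a * (p * M ^ (p - 1)) * (l + 1) ^ 8 with hc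
  have hc0 : 0 ≤ c := by positivity
  obtain ⟨R, hR1, hR⟩ : ∃ R : ℝ, l < R ∧ c * (tailConst n (n - 4) 8 * (R ^ 4)⁻¹) < 1 / 4 := by
    have h1 : Tendsto (fun R : ℝ => c * (tailConst n (n - 4) 8 * (R ^ 4)⁻¹)) atTop
        (𝓝 (c * (tailConst n (n - 4) 8 * 0))) :=
      ((tendsto_inv_atTop_zero.comp (tendsto_pow_atTop (by norm_num))).const_mul _).const_mul _
    have h2 := h1.eventually_lt_const (u := 1 / 4) (by norm_num)
    obtain ⟨R, hR, hR'⟩ := (h2.and (eventually_gt_atTop l)).exists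
    exact ⟨R, hR', hR⟩
  have hR0 := hl.trans hR1
  set b := c * l ^ (-(8 : ℝ)) with hb
  have hb0 : 0 ≤ b := by positivity
  obtain ⟨δ, hδ0, hδ⟩ : ∃ δ : ℝ, 0 < δ ∧ b * (δ ^ (4 : ℝ) * inMass n (n - 4)) < 1 / 8 := by
    have h1 : Tendsto (fun δ : ℝ => b * (δ ^ (4 : ℝ) * inMass n (n - 4))) (𝓝 0)
        (𝓝 (b * ((0 : ℝ) ^ (4 : ℝ) * inMass n (n - 4)))) := by
      refine Continuous.tendsto ?_ 0
      exact continuous_const.mul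
        ((continuous_id.rpow_const fun _ => Or.inr (by norm_num)).mul continuous_const)
    have h2 := h1.eventually_lt_const (u := 1 / 8)
      (by rw [Real.zero_rpow (by norm_num)]; norm_num)
    obtain ⟨δ, hδ, hδ'⟩ := ((h2.filter_mono nhdsWithin_le_nhds).and
      (self_mem_nhdsWithin : Set.Ioi (0 : ℝ) ∈ 𝓝[>] 0)).exists
    exact ⟨δ, hδ', hδ⟩
  have hvol : ∀ᶠ s in 𝓝[>] l, b * (δ ^ (-((n : ℝ) - 4)) * volume.real (bad s v ∩ ball 0 R)) < 1 / 8 := by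
    have h1 := ((hv.tendsto_measure_bad hl h R).const_mul (δ ^ (-((n : ℝ) - 4)))).const_mul b
    exact h1.eventually_lt_const (by norm_num)
  filter_upwards [hvol, self_mem_nhdsWithin, (Iio_mem_nhds (lt_add_one l) : _ ∈ 𝓝 l) |> mem_nhdsWithin_of_mem_nhds]
    with s hs hls hs1
  have hls' : l < s := hls
  have hs1' : s < l + 1 := hs1
  have hs0 : 0 < s := hl.trans hls'
  refine hv.kel_le_of_weight_le hs0 fun x hx => ?_
  set f : Eu n → ℝ := fun z => ker ((n : ℝ) - 4) x z * ‖z‖ ^ (-(8 : ℝ)) with hf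
  have hf0 : ∀ z, 0 ≤ f z := fun z =>
    mul_nonneg (ker_nonneg _ _ _) (Real.rpow_nonneg (norm_nonneg _) _)
  obtain ⟨i1, i2⟩ := integrableOn_weight hv.five_le hR0 x
  have hsub := (bad_subset (v := v) s).trans (compl_closedBall_subset s)
  have hfi : IntegrableOn f (bad s v) := (integrableOn_weight hv.five_le hs0 x).1.mono_set hsub
  have hfin : volume (bad s v ∩ ball 0 R) ≠ ⊤ :=
    ((measure_mono Set.inter_subset_right).trans_lt measure_ball_lt_top).ne
  have hbm := measurableSet_bad hv.continuous s
  rw [← integral_inter_add_sdiff (measurableSet_ball (x := (0 : Eu n)) (ε := R)) hfi]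
  have e1 : ∫ z in bad s v \ ball 0 R, f z ≤ tailConst n (n - 4) 8 * (R ^ 4)⁻¹ :=
    (setIntegral_mono_set i1 (Eventually.of_forall hf0)
      (show bad s v \ ball 0 R ⊆ (ball 0 R)ᶜ from fun z hz => hz.2).eventuallyLE).trans i2
  have e2 : ∫ z in bad s v ∩ ball 0 R, f z ≤
      l ^ (-(8 : ℝ)) * (δ ^ (4 : ℝ) * inMass n (n - 4) +
        δ ^ (-((n : ℝ) - 4)) * volume.real (bad s v ∩ ball 0 R)) := by
    have h1 := setIntegral_ker_le hv.five_le (s := (n : ℝ) - 4) (by linarith) (by linarith) x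
      (hbm.inter measurableSet_ball) hfin hδ0
    rw [show (n : ℝ) - (n - 4) = 4 by ring] at h1
    refine le_trans ?_ (mul_le_mul_of_nonneg_left h1 (by positivity))
    rw [← integral_const_mul]
    refine setIntegral_mono_on (hfi.mono_set Set.inter_subset_left)
      ((integrableOn_ker hv.five_le (by linarith) (by linarith) x hfin).const_mul _)
      (hbm.inter measurableSet_ball) fun z hz => ?_
    simp only [hf]
    rw [mul_comm]
    refine mul_le_mul_of_nonneg_right ?_ (ker_nonneg _ _ _)
    exact Real.rpow_le_rpow_of_nonpos hl (hls'.trans hz.1.1).le (by norm_num)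
  have hI0 : 0 ≤ (∫ z in bad s v ∩ ball 0 R, f z) + ∫ z in bad s v \ ball 0 R, f z :=
    add_nonneg (integral_nonneg hf0) (integral_nonneg hf0)
  have hcs : a * (p * M ^ (p - 1)) * s ^ 8 ≤ c := by
    rw [hc]
    gcongr
  refine (mul_le_mul_of_nonneg_right hcs hI0).trans ?_
  refine (mul_le_mul_of_nonneg_left (add_le_add e2 e1) hc0).trans ?_
  have e3 : c * (l ^ (-(8 : ℝ)) * (δ ^ (4 : ℝ) * inMass n (n - 4) +
        δ ^ (-((n : ℝ) - 4)) * volume.real (bad s v ∩ ball 0 R)) +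
        tailConst n (n - 4) 8 * (R ^ 4)⁻¹) =
      b * (δ ^ (4 : ℝ) * inMass n (n - 4)) +
        b * (δ ^ (-((n : ℝ) - 4)) * volume.real (bad s v ∩ ball 0 R)) +
        c * (tailConst n (n - 4) 8 * (R ^ 4)⁻¹) := by
    rw [hb]; ring
  rw [e3]
  linarith

/-- In the subcritical range the comparison holds for spheres of every radius. -/
lemma kel_le (hv : IsIntegralSol n p M a v) {l : ℝ} (hl : 0 < l) :
    ∀ z, l < ‖z‖ → kel l v z ≤ v z := by
  obtain ⟨l₀, hl₀, hsmall⟩ := hv.exists_small_good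
  rcases le_or_gt l l₀ with hle | hlt
  · exact hsmall l hl hle
  set s : Set ℝ := {r | ∀ z, r < ‖z‖ → kel r v z ≤ v z} with hs
  have hclosed : IsClosed (s ∩ Set.Icc l₀ l) := by
    refine isSeqClosed_iff_isClosed.1 fun r r₀ hr hlim => ⟨fun z hz => ?_, ?_⟩
    · refine le_of_tendsto
        (((continuous_kel_radius hv.five_le hv.continuous z).tendsto r₀).comp hlim) ?_
      filter_upwards [hlim.eventually_lt_const hz] with k hk using (hr k).1 z hk
    · exact isClosed_Icc.mem_of_tendsto hlim (Eventually.of_forall fun k => (hr k).2)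
  exact hclosed.Icc_subset_of_forall_mem_nhdsWithin (hsmall l₀ hl₀ le_rfl)
    (fun r hr => hv.eventually_good (hl₀.trans_le hr.2.1) hr.1) ⟨hlt.le, le_rfl⟩

lemma translate (hv : IsIntegralSol n p M a v) (x₀ : Eu n) :
    IsIntegralSol n p M a (fun x => v (x₀ + x)) := by
  have hk : ∀ x : Eu n, (fun y => ker ((n : ℝ) - 4) x y * v (x₀ + y) ^ p) =
      fun y => ker ((n : ℝ) - 4) (x₀ + x) (x₀ + y) * v (x₀ + y) ^ p := fun x => by
    ext1 y
    simp only [ker, add_sub_add_left_eq_sub]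
  refine ⟨hv.five_le, hv.one_lt, hv.subcritical, hv.coeff_pos,
    hv.continuous.comp (by fun_prop), fun x => hv.pos _, fun x => hv.le _, fun x => ?_, fun x => ?_⟩
  · rw [hk]
    exact (hv.integrable (x₀ + x)).comp_add_left x₀
  · rw [hk, integral_add_left_eq_self (fun y => ker ((n : ℝ) - 4) (x₀ + x) y * v y ^ p) x₀]
    exact hv.eq _

/-- Subcritical bounded positive solutions do not exist. -/
lemma false (hv : IsIntegralSol n p M a v) : False := by
  have hn' : (5 : ℝ) ≤ n := by exact_mod_cast hv.five_le
  have hle : ∀ y z : Eu n, y ≠ z → v z ≤ v y := by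
    intro y z hyz
    have hd : 0 < ‖y - z‖ := norm_pos_iff.2 (sub_ne_zero.2 hyz)
    have hs : ∀ s : ℝ, 0 < s → (s / (1 + s)) ^ (((n : ℝ) - 4) / 2) * v z ≤ v y := by
      intro s hs
      set x : Eu n := z - s • (y - z) with hx
      set l := Real.sqrt (s * (1 + s)) * ‖y - z‖ with hl
      have hl0 : 0 < l := by positivity
      have hyx : y - x = (1 + s) • (y - z) := by rw [hx, add_smul, one_smul]; abel
      have hnyx : ‖y - x‖ = (1 + s) * ‖y - z‖ := by
        rw [hyx, norm_smul, Real.norm_of_nonneg (by positivity)]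
      have hsq : Real.sqrt (s * (1 + s)) ^ 2 = s * (1 + s) := Real.sq_sqrt (by positivity)
      have hlt : l < ‖y - x‖ := by
        rw [hnyx, hl]
        refine mul_lt_mul_of_pos_right ?_ hd
        rw [Real.sqrt_lt' (by positivity)]
        nlinarith
      have hq : (l / ‖y - x‖) ^ 2 = s / (1 + s) := by
        rw [hnyx, hl, div_pow, mul_pow, mul_pow, hsq]
        field_simp
      have hq0 : 0 ≤ l / ‖y - x‖ := by positivity
      have h1 := (hv.translate x).kel_le hl0 (y - x) hlt
      have h2 : x + inv l (y - x) = z := by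
        rw [inv, hq, hyx, smul_smul, div_mul_cancel₀ _ (by positivity), hx]
        abel
      rw [kel, h2, add_sub_cancel] at h1
      convert h1 using 2
      rw [← hq, ← Real.rpow_natCast, ← Real.rpow_mul hq0]
      congr 1
      push_cast
      ring
    have hlim : Tendsto (fun s : ℝ => (s / (1 + s)) ^ (((n : ℝ) - 4) / 2) * v z) atTop
        (𝓝 (1 ^ (((n : ℝ) - 4) / 2) * v z)) := by
      refine Tendsto.mul_const _ (Tendsto.rpow_const ?_ (Or.inl one_ne_zero))
      have h1 : Tendsto (fun s : ℝ => 1 - (1 + s)⁻¹) atTop (𝓝 (1 - 0)) :=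
        (tendsto_inv_atTop_zero.comp (tendsto_atTop_add_const_left _ 1 tendsto_id)).const_sub 1
      rw [sub_zero] at h1
      refine h1.congr' ?_
      filter_upwards [eventually_gt_atTop 0] with s hs
      field_simp
      ring
    rw [Real.one_rpow, one_mul] at hlim
    exact le_of_tendsto hlim (by filter_upwards [eventually_gt_atTop 0] with s hs0 using hs s hs0)
  have hconst : ∀ y, v y = v 0 := fun y => by
    by_cases hy : y = 0
    · rw [hy]
    · exact le_antisymm (hle 0 y (Ne.symm hy)) (hle y 0 hy)
  have h0 : 0 < v 0 ^ p := Real.rpow_pos_of_pos (hv.pos 0) _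
  have hi := hv.integrable 0
  simp_rw [hconst] at hi
  exact not_integrable_ker hv.five_le _ 0 ((integrable_mul_const_iff h0.ne'.isUnit _).1 hi)

end IsIntegralSol

end MovingSpheres

section Liouville

variable {n : ℕ}

/-- The right-hand side `v^p`, cut off at radius `2 * R`. -/
noncomputable def cutSource (p R : ℝ) (v : Eu n → ℝ) (y : Eu n) : ℝ := cut n (R⁻¹ • y) * v y ^ p

variable {p M R : ℝ} {v : Eu n → ℝ}

lemma cutSource_eq_zero (hR : 0 < R) {y : Eu n} (hy : 2 * R ≤ ‖y‖) : cutSource p R v y = 0 := by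
  rw [cutSource, cut_eq_zero, zero_mul]
  rw [norm_smul, norm_inv, Real.norm_of_nonneg hR.le, ← div_eq_inv_mul, le_div_iff₀ hR]
  exact hy

lemma cutSource_eq (hR : 0 < R) {y : Eu n} (hy : ‖y‖ ≤ R) : cutSource p R v y = v y ^ p := by
  rw [cutSource, cut_eq_one, one_mul]
  rw [norm_smul, norm_inv, Real.norm_of_nonneg hR.le, ← div_eq_inv_mul, div_le_iff₀ hR, one_mul]
  exact hy

lemma measurable_cutSource (hR : 0 < R) (hp : 1 < p) (hv : ContinuousOn v (ball 0 (3 * R))) :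
    Measurable (cutSource p R v) := by
  classical
  have h : cutSource p R v = (ball 0 (3 * R)).piecewise (cutSource p R v) (fun _ => 0) := by
    ext y
    by_cases hy : y ∈ ball (0 : Eu n) (3 * R)
    · rw [Set.piecewise_eq_of_mem _ _ _ hy]
    · rw [Set.piecewise_eq_of_notMem _ _ _ hy]
      have : 3 * R ≤ ‖y‖ := by simpa using hy
      exact cutSource_eq_zero hR (by linarith)
  rw [h]
  refine ContinuousOn.measurable_piecewise ?_ continuousOn_const measurableSet_ball
  refine ContinuousOn.mul ?_ (hv.rpow_const fun _ _ => Or.inr (by linarith))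
  exact ((cut n).continuous.comp (by fun_prop)).continuousOn

lemma cutSource_mem (hR : 0 < R) (hp : 1 < p) (hM : 0 ≤ M)
    (hv : ∀ y ∈ ball 0 (3 * R), v y ∈ Set.Icc 0 M) (y : Eu n) :
    0 ≤ cutSource p R v y ∧ cutSource p R v y ≤ M ^ p := by
  rcases le_or_gt (2 * R) ‖y‖ with h | h
  · rw [cutSource_eq_zero hR h]
    exact ⟨le_rfl, by positivity⟩
  · have hy := hv y (by rw [mem_ball_zero_iff]; linarith)
    have h1 : 0 ≤ v y ^ p := Real.rpow_nonneg hy.1 _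
    have h2 : v y ^ p ≤ M ^ p := Real.rpow_le_rpow hy.1 hy.2 (by linarith)
    have h3 : 0 ≤ cut n (R⁻¹ • y) := (cut n).nonneg
    have h4 : cut n (R⁻¹ • y) ≤ 1 := (cut n).le_one
    unfold cutSource
    constructor
    · positivity
    · nlinarith

lemma integrable_ker_mul_cutSource (hn : 5 ≤ n) (hR : 0 < R) (hp : 1 < p) (hM : 0 ≤ M)
    (hvc : ContinuousOn v (ball 0 (3 * R)))
    (hv : ∀ y ∈ ball 0 (3 * R), v y ∈ Set.Icc 0 M) (x : Eu n) :
    Integrable fun y => ker ((n : ℝ) - 4) x y * cutSource p R v y := by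
  have hn' : (5 : ℝ) ≤ n := by exact_mod_cast hn
  have h1 : Integrable ((ball (0 : Eu n) (2 * R)).indicator
      fun y => M ^ p * ker ((n : ℝ) - 4) x y) :=
    (integrable_indicator_iff measurableSet_ball).2
      ((integrableOn_ker hn (by linarith) (by linarith) x measure_ball_lt_top.ne).const_mul _)
  refine h1.mono' ((measurable_ker _ x).mul (measurable_cutSource hR hp hvc)).aestronglyMeasurable
    (Eventually.of_forall fun y => ?_)
  have h2 := cutSource_mem hR hp hM hv y
  have h3 := ker_nonneg ((n : ℝ) - 4) x y
  rw [Real.norm_of_nonneg (mul_nonneg h3 h2.1)]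
  by_cases hy : y ∈ ball (0 : Eu n) (2 * R)
  · rw [Set.indicator_of_mem hy, mul_comm]
    exact mul_le_mul_of_nonneg_right h2.2 h3
  · rw [Set.indicator_of_notMem hy, cutSource_eq_zero hR (by simpa using hy), mul_zero]

/-- Bounded solutions normalised at the centre exist only on balls of bounded radius. -/
lemma exists_radius (hn : 5 ≤ n) (hp : 1 < p) (hp2 : ((n : ℝ) - 4) * p < n + 4) (hM : 0 ≤ M) :
    ∃ R : ℝ, 0 < R ∧ ∀ v : Eu n → ℝ, ContDiffOn ℝ 4 v (ball 0 (3 * R)) →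
      (∀ y ∈ ball 0 (3 * R), v y ∈ Set.Icc 0 M) → v 0 = 1 →
      ¬ ∀ y ∈ ball 0 (3 * R), bilap v y = v y ^ p := by
  by_contra! H
  obtain ⟨K, hK0, hK⟩ := exists_repr hn
  have hk0 : ∀ k : ℕ, (0 : ℝ) < k + 1 := fun k => by positivity
  choose v hvs hvM hv1 hveq using fun k : ℕ => H (k + 1) (hk0 k)
  have hvc := fun k => (hvs k).continuousOn
  have hker : ∀ (k : ℕ) (x : Eu n), ∫ y, cut n (((k : ℝ) + 1)⁻¹ • y) * ker ((n : ℝ) - 4) x y *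
      bilap (v k) y = ∫ y, ker ((n : ℝ) - 4) x y * cutSource p (k + 1) (v k) y := by
    intro k x
    congr 1
    ext1 y
    by_cases hy : y ∈ ball (0 : Eu n) (3 * (k + 1))
    · rw [hveq k y hy, cutSource]
      ring
    · have h3 : 3 * ((k : ℝ) + 1) ≤ ‖y‖ := by simpa using hy
      have h2 : 2 * ((k : ℝ) + 1) ≤ ‖y‖ := by linarith [hk0 k]
      rw [cutSource_eq_zero (hk0 k) h2, cut_eq_zero]
      · ring
      · rw [norm_smul, norm_inv, Real.norm_of_nonneg (hk0 k).le, ← div_eq_inv_mul,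
          le_div_iff₀ (hk0 k)]
        exact h2
  obtain ⟨w, hwc, hwM, hw1, c₀, hw⟩ := exists_limit hn hp hM (mul_nonneg hK0 hM) (G := M ^ p)
    (v := v) (g := fun k => cutSource p (k + 1) (v k))
    (fun k x hx => hvM k x (closedBall_subset_ball (by linarith [hk0 k]) hx))
    (fun k => measurable_cutSource (hk0 k) hp (hvc k))
    (fun k y => cutSource_mem (hk0 k) hp hM (hvM k) y)
    (fun k x hx => cutSource_eq (hk0 k) (by simpa using hx))
    (fun k x => integrable_ker_mul_cutSource hn (hk0 k) hp hM (hvc k) (hvM k) x)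
    (fun k x hx x' hx' => by
      have h := hK (k + 1) (hk0 k) (v k) (hvs k) M
        (fun y hy => by rw [abs_of_nonneg (hvM k y hy).1]; exact (hvM k y hy).2) x hx x' hx'
      rwa [hker, hker] at h)
  have hw1 := hw1 hv1
  have hc := reprConst_pos hn
  have hc₀ := const_eq_zero hn hp hc hwc hwM (fun x => (hw x).1) (fun x => (hw x).2)
  have hnn : ∀ x y, 0 ≤ ker ((n : ℝ) - 4) x y * w y ^ p := fun x y =>
    mul_nonneg (ker_nonneg _ _ _) (Real.rpow_nonneg (hwM y).1 _)
  have hpos : ∀ x, 0 < w x := by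
    intro x
    refine (hwM x).1.lt_of_ne fun h0 => ?_
    have h1 := (hw x).2
    rw [← h0, hc₀, mul_zero, add_zero, eq_comm,
      integral_eq_zero_iff_of_nonneg (hnn x) (hw x).1] at h1
    have h2 : w =ᵐ[volume] fun _ => 0 := by
      filter_upwards [h1, ae_ne hn x] with y hy hxy
      have h3 := (mul_eq_zero.1 hy).resolve_left (ker_pos hxy).ne'
      exact (Real.rpow_eq_zero (hwM y).1 (by linarith)).1 h3
    have h3 := (Continuous.ae_eq_iff_eq volume hwc continuous_const).1 h2
    rw [h3] at hw1
    exact zero_ne_one hw1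
  have hsol : IsIntegralSol n p M (reprConst n)⁻¹ w :=
    ⟨hn, hp, hp2, inv_pos.2 hc, hwc, hpos, fun x => (hwM x).2, fun x => (hw x).1, fun x => by
      have := (hw x).2
      rw [hc₀, add_zero] at this
      rw [← this, inv_mul_cancel_left₀ hc.ne']⟩
  exact hsol.false

end Liouville

/-- The doubling argument: the singularity estimate follows by rescaling at a maximum point. -/
lemma singularity_estimate {n : ℕ} (hn : 5 ≤ n) {p : ℝ} (hp : 1 < p)
    (hp2 : ((n : ℝ) - 4) * p < n + 4) :
    ∃ C : ℝ, ∀ u : Eu n → ℝ, ContDiffOn ℝ 4 u (ball 0 1 \ {0}) →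
      (∀ x ∈ ball (0 : Eu n) 1 \ {0}, 0 ≤ u x) →
      (∀ x ∈ ball (0 : Eu n) 1 \ {0}, bilap u x = u x ^ p) →
      ∀ x : Eu n, x ≠ 0 → ‖x‖ ≤ 1 / 2 → u x ≤ C * ‖x‖ ^ (-((4 : ℝ) / (p - 1))) := by
  have hp1 : 0 < p - 1 := by linarith
  set β := 4 / (p - 1) with hβ
  have hβ0 : 0 < β := by positivity
  obtain ⟨R, hR, hno⟩ := exists_radius hn hp hp2 (M := 2 ^ β) (by positivity)
  refine ⟨(12 * R) ^ β, fun u hus hu0 hueq x₀ hx₀ hx₀' => ?_⟩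
  by_contra! hlt
  have hx0 : 0 < ‖x₀‖ := norm_pos_iff.2 hx₀
  set r := ‖x₀‖ / 2 with hr
  have hr0 : 0 < r := by positivity
  have hsub : closedBall x₀ r ⊆ ball (0 : Eu n) 1 \ {0} := by
    intro x hx
    rw [mem_closedBall, dist_eq_norm] at hx
    have h1 : ‖x‖ ≤ ‖x₀‖ + ‖x - x₀‖ := by simpa using norm_add_le x₀ (x - x₀)
    have h2 : ‖x₀‖ ≤ ‖x‖ + ‖x - x₀‖ := by simpa using norm_sub_le x (x - x₀)
    refine ⟨by rw [mem_ball_zero_iff]; linarith, ?_⟩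
    rw [Set.mem_singleton_iff, ← ne_eq, ← norm_pos_iff]
    linarith
  set F : Eu n → ℝ := fun x => (r - ‖x - x₀‖) ^ β * u x with hF
  have hFc : ContinuousOn F (closedBall x₀ r) := by
    refine ContinuousOn.mul ?_ (hus.continuousOn.mono hsub)
    refine (Continuous.rpow_const (by fun_prop) fun _ => Or.inr hβ0.le).continuousOn
  obtain ⟨y, hy, hmax⟩ := (isCompact_closedBall x₀ r).exists_isMaxOn
    ⟨x₀, mem_closedBall_self hr0.le⟩ hFc
  have hmax : ∀ x ∈ closedBall x₀ r, F x ≤ F y := fun x hx => hmax hx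
  have hFx₀ : (6 * R) ^ β < F x₀ := by
    simp only [hF, sub_self, norm_zero, sub_zero]
    have h1 : (6 * R) ^ β = r ^ β * ((12 * R) ^ β * ‖x₀‖ ^ (-β)) := by
      rw [Real.rpow_neg hx0.le, ← Real.inv_rpow hx0.le, ← Real.mul_rpow (by positivity) (by positivity),
        ← Real.mul_rpow (by positivity) (by positivity), hr]
      congr 1
      field_simp
      norm_num
    rw [h1]
    exact mul_lt_mul_of_pos_left hlt (by positivity)
  have hFy := hFx₀.trans_le (hmax x₀ (mem_closedBall_self hr0.le))
  have huy0 := hu0 y (hsub hy)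
  set d := r - ‖y - x₀‖ with hd
  have hd0 : 0 ≤ d := by
    rw [mem_closedBall, dist_eq_norm] at hy
    linarith
  have hRβ : 0 < (6 * R) ^ β := by positivity
  have hFy' : (6 * R) ^ β < d ^ β * u y := hFy
  have hdpos : 0 < d := by
    refine hd0.lt_of_ne fun h => ?_
    rw [← h, Real.zero_rpow hβ0.ne', zero_mul] at hFy'
    exact hFy'.not_gt hRβ
  have huy : 0 < u y := by
    refine huy0.lt_of_ne fun h => ?_
    rw [← h, mul_zero] at hFy'
    exact hFy'.not_gt hRβ
  set μ := u y ^ (-(1 / β)) with hμ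
  have hμ0 : 0 < μ := by positivity
  have hμβ : μ ^ β = (u y)⁻¹ := by
    rw [hμ, ← Real.rpow_mul huy.le, neg_mul, one_div_mul_cancel hβ0.ne', Real.rpow_neg_one]
  have hμd : 6 * R * μ < d := by
    refine lt_of_not_ge fun h => hFy'.not_ge ?_
    have h1 := Real.rpow_le_rpow hd0 h hβ0.le
    rw [Real.mul_rpow (by positivity) hμ0.le, hμβ] at h1
    calc d ^ β * u y ≤ (6 * R) ^ β * (u y)⁻¹ * u y := mul_le_mul_of_nonneg_right h1 huy.le
      _ = (6 * R) ^ β := inv_mul_cancel_right₀ huy.ne' _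
  have hμ4 : (u y)⁻¹ * μ ^ 4 = ((u y)⁻¹) ^ p := by
    rw [← Real.rpow_natCast, hμ, ← Real.rpow_mul huy.le, ← Real.rpow_neg_one,
      ← Real.rpow_add huy, ← Real.rpow_mul huy.le]
    congr 1
    rw [hβ]
    push_cast
    field_simp
    ring
  have hloc : ∀ z ∈ ball (0 : Eu n) (3 * R), y + μ • z ∈ closedBall x₀ r ∧
      d / 2 ≤ r - ‖y + μ • z - x₀‖ := by
    intro z hz
    have hz' := mem_ball_zero_iff.1 hz
    have h1 : ‖y + μ • z - x₀‖ ≤ ‖y - x₀‖ + μ * ‖z‖ := by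
      rw [show y + μ • z - x₀ = (y - x₀) + μ • z by abel]
      refine (norm_add_le _ _).trans_eq ?_
      rw [norm_smul, Real.norm_of_nonneg hμ0.le]
    have h2 : μ * ‖z‖ ≤ μ * (3 * R) := mul_le_mul_of_nonneg_left hz'.le hμ0.le
    have h3 : d / 2 ≤ r - ‖y + μ • z - x₀‖ := by linarith
    refine ⟨?_, h3⟩
    rw [mem_closedBall, dist_eq_norm]
    linarith
  refine hno (fun z => (u y)⁻¹ * u (y + μ • z)) ?_ ?_ ?_ ?_
  · refine contDiffOn_const.mul (hus.comp (by fun_prop) fun z hz => hsub (hloc z hz).1)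
  · intro z hz
    obtain ⟨h1, h2⟩ := hloc z hz
    have hux := hu0 _ (hsub h1)
    refine ⟨by positivity, ?_⟩
    have h3 : (d / 2) ^ β * u (y + μ • z) ≤ d ^ β * u y :=
      (mul_le_mul_of_nonneg_right (Real.rpow_le_rpow (by positivity) h2 hβ0.le) hux).trans
        (hmax _ h1)
    rw [Real.div_rpow hd0 zero_le_two, div_mul_eq_mul_div, div_le_iff₀ (by positivity)] at h3
    have hdβ : 0 < d ^ β := by positivity
    rw [inv_mul_le_iff₀ huy]
    refine le_of_mul_le_mul_left ?_ hdβ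
    linarith
  · simp [huy.ne']
  · intro z hz
    have hmem := hsub (hloc z hz).1
    rw [bilap_const_mul (fun z => u (y + μ • z)), bilap_comp_affine, hueq _ hmem,
      Real.mul_rpow (by positivity) (hu0 _ hmem), ← mul_assoc, hμ4]

end Biharmonic

/-- Singularity estimate: there is `C = C(n,p)` such that every nonnegative
`C⁴` solution of `Δ²u = u^p` in the punctured unit ball satisfies
`u(x) ≤ C |x|^{-4/(p-1)}` for `0 < |x| ≤ 1/2`. -/
theorem stmt_2 (n : ℕ) (hn : 5 ≤ n) (p : ℝ)
    (hp1 : 1 < p) (hp2 : p < ((n : ℝ) + 4) / ((n : ℝ) - 4)) :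
    ∃ C : ℝ, ∀ u : EuclideanSpace ℝ (Fin n) → ℝ,
      ContDiffOn ℝ 4 u (ball 0 1 \ {0}) →
      (∀ x ∈ ball (0 : EuclideanSpace ℝ (Fin n)) 1 \ {0}, 0 ≤ u x) →
      (∀ x ∈ ball (0 : EuclideanSpace ℝ (Fin n)) 1 \ {0}, bilap u x = u x ^ p) →
      ∀ x : EuclideanSpace ℝ (Fin n), x ≠ 0 → ‖x‖ ≤ 1 / 2 →
        u x ≤ C * ‖x‖ ^ (-((4 : ℝ) / (p - 1))) := by
  have hn' : (5 : ℝ) ≤ n := by exact_mod_cast hn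
  refine Biharmonic.singularity_estimate hn hp1 ?_
  rw [lt_div_iff₀ (by linarith)] at hp2
  linarith
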